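/- Fix a positive integer n and let r, s ∈ ℝ^n be such that r = l(K) and s = l(K') for some n×n Hermitian matrices K, K' (equivalently, the sequences of consecutive differences r_1, r_2 − r_1, …, r_n − r_{n−1} and s_1, s_2 − s_1, …, s_n − s_{n−1} are nonincreasing). Then the Horn polytope Π_{r,s} = {l(K_1 + K_2) : K_1, K_2 n×n Hermitian, l(K_1) = r, l(K_2) = s} is a nonempty, compact, convex subset of ℝ^n. -/

import Mathlib

open Matrix

/-- The eigenvalues of a Hermitian matrix, listed in decreasing order:
`eigsDesc hA 0 = λ₁ ≥ eigsDesc hA 1 = λ₂ ≥ …`. -/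
noncomputable def eigsDesc {n : ℕ} {A : Matrix (Fin n) (Fin n) ℂ} (hA : A.IsHermitian) :
    Fin n → ℝ :=
  fun i => hA.eigenvalues (Tuple.sort hA.eigenvalues i.rev)
/-- `lMap hA i = λ₁ + … + λ_{i+1}`, the partial sums of the decreasingly ordered
eigenvalues of a Hermitian matrix (`i : Fin n` represents the index `i+1`). -/
noncomputable def lMap {n : ℕ} {A : Matrix (Fin n) (Fin n) ℂ} (hA : A.IsHermitian) :
    Fin n → ℝ :=
  fun i => ∑ j ∈ Finset.Iic i, eigsDesc hA j

namespace HornProof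

open scoped ComplexOrder

/-- The coordinate projection onto the first `i+1` coordinates. -/
noncomputable def Sm {n : ℕ} (i : Fin n) : Matrix (Fin n) (Fin n) ℂ :=
  diagonal (fun j => if j ≤ i then 1 else 0)

/-- There are Hermitian matrices with prescribed spectra with sum `c`. -/
def Feas {n : ℕ} (w : Fin 3 → Fin n → ℝ) (c : ℝ) : Prop :=
  ∃ U : Fin 3 → Matrix (Fin n) (Fin n) ℂ, (∀ a, U a ∈ unitaryGroup (Fin n) ℂ) ∧
    ∑ a, ∑ i, (w a i : ℂ) • (U a * Sm i * (U a)ᴴ) = (c : ℂ) • 1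

/-- Semistability of a triple of flags. -/
def SS {n : ℕ} (B : Fin 3 → Matrix (Fin n) (Fin n) ℂ) (w : Fin 3 → Fin n → ℝ) (c : ℝ) : Prop :=
  ∀ N : Matrix (Fin n) (Fin n) ℂ,
    c * (N.rank : ℝ) ≤ ∑ a, ∑ i, w a i * ((N * B a * Sm i).rank : ℝ)

lemma Sm_herm {n : ℕ} (i : Fin n) : (Sm i)ᴴ = Sm i := by
  unfold Sm
  rw [diagonal_conjTranspose]
  congr 1
  ext j
  simp only [Pi.star_apply]
  split_ifs <;> simp

lemma Sm_idem {n : ℕ} (i : Fin n) : Sm i * Sm i = Sm i := by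
  unfold Sm
  rw [diagonal_mul_diagonal]
  congr 1
  ext j
  split_ifs <;> simp

lemma Sm_last {n : ℕ} (i : Fin n) (hi : ∀ j, j ≤ i) : Sm i = 1 := by
  unfold Sm
  rw [← diagonal_one]
  congr 1
  ext j
  simp [hi j]

lemma spectral' {n : ℕ} {A : Matrix (Fin n) (Fin n) ℂ} (hA : A.IsHermitian) :
    A = (hA.eigenvectorUnitary : Matrix (Fin n) (Fin n) ℂ) *
      diagonal (fun i => (hA.eigenvalues i : ℂ)) *
      (hA.eigenvectorUnitary : Matrix (Fin n) (Fin n) ℂ)ᴴ := by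
  conv_lhs => rw [hA.spectral_theorem]
  rw [Unitary.conjStarAlgAut_apply]
  rfl

lemma unit1 {n : ℕ} {U : Matrix (Fin n) (Fin n) ℂ} (hU : U ∈ unitaryGroup (Fin n) ℂ) :
    U * Uᴴ = 1 := mem_unitaryGroup_iff.1 hU

lemma unit2 {n : ℕ} {U : Matrix (Fin n) (Fin n) ℂ} (hU : U ∈ unitaryGroup (Fin n) ℂ) :
    Uᴴ * U = 1 := mem_unitaryGroup_iff'.1 hU

lemma trace_le_rank {n : ℕ} {M : Matrix (Fin n) (Fin n) ℂ} (hM : M.IsHermitian)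
    (h1 : (1 - M).PosSemidef) : M.trace.re ≤ M.rank := by
  rw [hM.trace_eq_sum_eigenvalues, hM.rank_eq_card_non_zero_eigs]
  have hle : ∀ i, hM.eigenvalues i ≤ 1 := by
    intro i
    set U := (hM.eigenvectorUnitary : Matrix (Fin n) (Fin n) ℂ) with hU
    have hu : U ∈ unitaryGroup (Fin n) ℂ := hM.eigenvectorUnitary.2
    have h2 := h1.conjTranspose_mul_mul_same U
    have h3 : Uᴴ * (1 - M) * U = 1 - diagonal (fun i => (hM.eigenvalues i : ℂ)) := by
      conv_lhs => rw [spectral' hM]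
      rw [← hU, mul_sub, sub_mul, mul_one, unit2 hu]
      congr 1
      calc Uᴴ * (U * diagonal (fun i => (hM.eigenvalues i : ℂ)) * Uᴴ) * U
          = (Uᴴ * U) * diagonal (fun i => (hM.eigenvalues i : ℂ)) * (Uᴴ * U) := by
            simp only [mul_assoc]
        _ = _ := by rw [unit2 hu]; simp
    rw [h3] at h2
    have h4 := h2.diag_nonneg (i := i)
    simp at h4
    exact_mod_cast h4
  have : (Fintype.card {i // hM.eigenvalues i ≠ 0} : ℝ)
      = ∑ i, if hM.eigenvalues i ≠ 0 then (1 : ℝ) else 0 := by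
    rw [Fintype.card_subtype, Finset.card_filter]
    push_cast
    rfl
  rw [this]
  simp only [Complex.coe_algebraMap, Complex.re_sum, Complex.ofReal_re]
  apply Finset.sum_le_sum
  intro i _
  split_ifs with h
  · exact hle i
  · simp at h; simp [h]

/-- Orthogonal projection onto the row space of `N`. -/
lemma exists_row_proj {n : ℕ} (N : Matrix (Fin n) (Fin n) ℂ) :
    ∃ P Y : Matrix (Fin n) (Fin n) ℂ, Pᴴ = P ∧ P * P = P ∧ P = Y * N ∧ P.trace = N.rank := by
  have hA : (Nᴴ * N).IsHermitian := isHermitian_conjTranspose_mul_self N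
  set U := (hA.eigenvectorUnitary : Matrix (Fin n) (Fin n) ℂ) with hU
  have hu : U ∈ unitaryGroup (Fin n) ℂ := hA.eigenvectorUnitary.2
  set e := hA.eigenvalues with he
  let p : Fin n → ℂ := fun i => if e i = 0 then 0 else 1
  let q : Fin n → ℂ := fun i => if e i = 0 then 0 else (e i : ℂ)⁻¹
  refine ⟨U * diagonal p * Uᴴ, U * diagonal q * Uᴴ * Nᴴ, ?_, ?_, ?_, ?_⟩
  · simp only [conjTranspose_mul, conjTranspose_conjTranspose, diagonal_conjTranspose, mul_assoc]
    congr 3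
    ext j
    simp only [p, Pi.star_apply]
    split_ifs <;> simp
  · calc U * diagonal p * Uᴴ * (U * diagonal p * Uᴴ)
        = U * (diagonal p * (Uᴴ * U) * diagonal p) * Uᴴ := by simp only [mul_assoc]
      _ = _ := by
        rw [unit2 hu, mul_one, diagonal_mul_diagonal]
        congr 3
        ext j
        simp only [p]
        split_ifs <;> simp
  · calc U * diagonal p * Uᴴ = U * (diagonal q * diagonal (fun i => (e i : ℂ))) * Uᴴ := by
          rw [diagonal_mul_diagonal]
          congr 3
          ext j
          simp only [p, q]
          split_ifs with h
          · simp
          · rw [inv_mul_cancel₀]; exact_mod_cast h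
      _ = U * (diagonal q * (Uᴴ * U) * diagonal (fun i => (e i : ℂ))) * Uᴴ := by
          rw [unit2 hu, mul_one]
      _ = U * diagonal q * Uᴴ * (U * diagonal (fun i => (e i : ℂ)) * Uᴴ) := by
          simp only [mul_assoc]
      _ = U * diagonal q * Uᴴ * Nᴴ * N := by
          rw [mul_assoc _ Nᴴ N]
          congr 1
          exact (spectral' hA).symm
  · rw [trace_mul_cycle, unit2 hu, one_mul, trace_diagonal, ← rank_conjTranspose_mul_self N,
      hA.rank_eq_card_non_zero_eigs, Fintype.card_subtype]
    simp [p, Finset.sum_ite]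
    rfl

lemma proj_psd {n : ℕ} {P : Matrix (Fin n) (Fin n) ℂ} (h1 : Pᴴ = P) (h2 : P * P = P) :
    P.PosSemidef := by
  have := posSemidef_conjTranspose_mul_self P
  rwa [h1, h2] at this

lemma proj_compl {n : ℕ} {P : Matrix (Fin n) (Fin n) ℂ} (h1 : Pᴴ = P) (h2 : P * P = P) :
    (1 - P)ᴴ = 1 - P ∧ (1 - P) * (1 - P) = 1 - P := by
  constructor
  · simp [h1]
  · simp [mul_sub, sub_mul, h2]

lemma trace_mul_le_rank {n : ℕ} {P Q : Matrix (Fin n) (Fin n) ℂ} (h1 : Pᴴ = P) (h2 : P * P = P)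
    (k1 : Qᴴ = Q) (k2 : Q * Q = Q) : (P * Q).trace.re ≤ (P * Q).rank := by
  have e1 : (P * Q).trace = (Q * P * Q).trace := by
    rw [trace_mul_comm (Q * P) Q, ← mul_assoc, k2, trace_mul_comm]
  have hH : (Q * P * Q).IsHermitian := by
    simp [IsHermitian, k1, h1, mul_assoc]
  have hp : (1 - Q * P * Q).PosSemidef := by
    have a1 := proj_psd (proj_compl k1 k2).1 (proj_compl k1 k2).2
    have a2 := (proj_psd (proj_compl h1 h2).1 (proj_compl h1 h2).2).conjTranspose_mul_mul_same Q
    have a3 := a1.add a2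
    have : 1 - Q + Qᴴ * (1 - P) * Q = 1 - Q * P * Q := by
      rw [k1, mul_sub, sub_mul, mul_one, k2]; abel
    rwa [this] at a3
  rw [e1]
  refine (trace_le_rank hH hp).trans ?_
  rw [mul_assoc]
  exact_mod_cast rank_mul_le_right Q (P * Q)

lemma conj_proj {n : ℕ} {U : Matrix (Fin n) (Fin n) ℂ} (hU : U ∈ unitaryGroup (Fin n) ℂ)
    (i : Fin n) : (U * Sm i * Uᴴ)ᴴ = U * Sm i * Uᴴ ∧
      (U * Sm i * Uᴴ) * (U * Sm i * Uᴴ) = U * Sm i * Uᴴ := by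
  constructor
  · simp [mul_assoc, Sm_herm]
  · calc (U * Sm i * Uᴴ) * (U * Sm i * Uᴴ) = U * (Sm i * (Uᴴ * U) * Sm i) * Uᴴ := by
          simp only [mul_assoc]
      _ = _ := by rw [unit2 hU, mul_one, Sm_idem]

lemma feas_proj {n : ℕ} {w : Fin 3 → Fin n → ℝ} {c : ℝ} (hw : ∀ a i, 0 ≤ w a i)
    {U : Fin 3 → Matrix (Fin n) (Fin n) ℂ} (hU : ∀ a, U a ∈ unitaryGroup (Fin n) ℂ)
    (h : ∑ a, ∑ i, (w a i : ℂ) • (U a * Sm i * (U a)ᴴ) = (c : ℂ) • 1)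
    {P : Matrix (Fin n) (Fin n) ℂ} (h1 : Pᴴ = P) (h2 : P * P = P) :
    c * P.trace.re ≤ ∑ a, ∑ i, w a i * ((P * U a * Sm i).rank : ℝ) := by
  have h3 := congrArg (fun X => (P * X).trace.re) h
  simp only [mul_one, trace_smul, Finset.mul_sum, trace_sum, Complex.re_sum, mul_smul_comm,
    smul_eq_mul, Complex.re_ofReal_mul] at h3
  rw [← h3]
  refine Finset.sum_le_sum fun a _ => Finset.sum_le_sum fun i _ => ?_
  refine mul_le_mul_of_nonneg_left ?_ (hw a i)
  refine (trace_mul_le_rank h1 h2 (conj_proj (hU a) i).1 (conj_proj (hU a) i).2).trans ?_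
  have : P * (U a * Sm i * (U a)ᴴ) = P * U a * Sm i * (U a)ᴴ := by simp only [mul_assoc]
  rw [this]
  exact_mod_cast rank_mul_le_left _ _

lemma feas_trace {n : ℕ} {w : Fin 3 → Fin n → ℝ} {c : ℝ}
    (h : Feas w c) : ∑ a, ∑ i : Fin n, w a i * ((i : ℝ) + 1) = c * n := by
  obtain ⟨U, hU, h⟩ := h
  have h3 := congrArg (fun X => X.trace.re) h
  have key : ∀ a (i : Fin n), (U a * Sm i * (U a)ᴴ).trace = ((i : ℕ) : ℂ) + 1 := by
    intro a i
    rw [trace_mul_cycle, unit2 (hU a), one_mul, Sm, trace_diagonal, Finset.sum_ite]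
    have : (Finset.univ.filter (fun j => j ≤ i)) = Finset.Iic i := by ext; simp
    simp [this]
  simp only [trace_smul, trace_sum, Complex.re_sum, smul_eq_mul, Complex.re_ofReal_mul, key] at h3
  simpa using h3
lemma rank_map_hom {n : ℕ} (σ : ℂ →+* ℂ) (M : Matrix (Fin n) (Fin n) ℂ) :
    (M.map σ).rank = M.rank := by
  obtain ⟨V, U, e, hV, hU, h⟩ := exists_rank_normal_form M
  set J : Matrix (Fin n) (Fin n) ℂ := (fromBlocks 1 0 0 0).submatrix e e with hJ
  have hJσ : J.map σ = J := by
    rw [hJ]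
    ext i j
    simp only [map_apply, submatrix_apply]
    rcases e i with a | a <;> rcases e j with b | b <;> simp [fromBlocks, one_apply]
  have hVd : IsUnit V.det := (isUnit_iff_isUnit_det V).1 hV
  have hUd : IsUnit U.det := (isUnit_iff_isUnit_det U).1 hU
  have h2 : V.map σ * M.map σ * U.map σ = J := by
    rw [← hJσ, ← h, Matrix.map_mul, Matrix.map_mul]
  have hd : ∀ X : Matrix (Fin n) (Fin n) ℂ, IsUnit X.det → IsUnit (X.map σ).det := by
    intro X hX
    have := RingHom.map_det σ X
    rw [RingHom.mapMatrix_apply] at this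
    rw [← this]
    exact hX.map σ
  have r1 : M.rank = J.rank := by
    rw [← h, rank_mul_eq_left_of_isUnit_det _ _ hUd, rank_mul_eq_right_of_isUnit_det _ _ hVd]
  rw [r1, ← h2, rank_mul_eq_left_of_isUnit_det _ _ (hd U hUd),
    rank_mul_eq_right_of_isUnit_det _ _ (hd V hVd)]

lemma isClosed_rank_le {n : ℕ} (d : ℕ) :
    IsClosed {M : Matrix (Fin n) (Fin n) ℂ | M.rank ≤ d} := by
  rw [← isOpen_compl_iff, isOpen_iff_mem_nhds]
  intro M hM
  obtain ⟨V, U, e, hV, hU, h⟩ := exists_rank_normal_form M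
  let g : Fin M.rank → Fin n := fun a => e.symm (Sum.inl a)
  let φ : Matrix (Fin n) (Fin n) ℂ → ℂ := fun X => ((V * X * U).submatrix g g).det
  have hφ : Continuous φ := by
    unfold φ
    fun_prop
  have h1 : φ M = 1 := by
    have : (V * M * U).submatrix g g = 1 := by
      rw [h]
      ext i j
      simp [g]
    simp [φ, this]
  have h2 : ∀ᶠ X in nhds M, φ X ≠ 0 := hφ.continuousAt.eventually_ne (by rw [h1]; exact one_ne_zero)
  filter_upwards [h2] with X hX
  simp only [Set.mem_compl_iff, Set.mem_ofPred_eq, not_le] at hM ⊢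
  refine hM.trans_le ?_
  have a1 : ((V * X * U).submatrix g g).rank = M.rank := by
    rw [rank_of_det_ne_zero hX]; simp
  rw [← a1]
  have a2 : ((V * X * U).submatrix g g).rank ≤ (V * X * U).rank := rank_submatrix_le _ _ _
  exact a2.trans ((rank_mul_le_left _ _).trans (rank_mul_le_right _ _))

lemma exists_shift_hom {k : Type*} [Field k] [Algebra k ℂ] {ι : Type*} {x : ι → ℂ}
    (hx : IsTranscendenceBasis k x) (b : ι → k) :
    ∃ σ : ℂ →+* ℂ, ∀ i, σ (x i) = x i + algebraMap k ℂ (b i) := by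
  classical
  let y : ι → ℂ := fun i => x i + algebraMap k ℂ (b i)
  have hy : AlgebraicIndependent k y := by
    let f : MvPolynomial ι k →ₐ[k] MvPolynomial ι k :=
      MvPolynomial.aeval (fun i => MvPolynomial.X i + MvPolynomial.C (b i))
    let g : MvPolynomial ι k →ₐ[k] MvPolynomial ι k :=
      MvPolynomial.aeval (fun i => MvPolynomial.X i - MvPolynomial.C (b i))
    have hgf : g.comp f = AlgHom.id k _ := by
      ext i : 1
      simp only [f, g, AlgHom.comp_apply, MvPolynomial.aeval_X, map_add, AlgHom.id_apply]
      rw [← MvPolynomial.algebraMap_eq, AlgHom.commutes]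
      ring
    have hf : Function.Injective f := by
      intro p q hpq
      have := congrArg g hpq
      rw [← AlgHom.comp_apply, ← AlgHom.comp_apply, hgf] at this
      simpa using this
    have hcomp : MvPolynomial.aeval y = (MvPolynomial.aeval x).comp f := by
      ext i : 1
      simp [f, y, AlgHom.comp_apply, ← MvPolynomial.algebraMap_eq]
    rw [AlgebraicIndependent, hcomp]
    exact Function.Injective.comp (g := MvPolynomial.aeval x) hx.1 hf
  let R := Algebra.adjoin k (Set.range x)
  let φ : R →+* ℂ :=
    (MvPolynomial.aeval y : MvPolynomial ι k →ₐ[k] ℂ).toRingHom.comp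
      hx.1.aevalEquiv.symm.toRingEquiv.toRingHom
  have hφ : Function.Injective φ := by
    exact Function.Injective.comp (g := MvPolynomial.aeval y) (f := hx.1.aevalEquiv.symm)
      hy hx.1.aevalEquiv.symm.injective
  have halg : Algebra.IsAlgebraic R ℂ := hx.isAlgebraic
  -- a copy of the algebra structure through φ
  obtain ⟨σ, hσ⟩ : ∃ σ : ℂ →+* ℂ, ∀ r : R, σ (r : ℂ) = φ r := by
    have htf : Module.IsTorsionFree R ℂ := inferInstance
    have key : ∀ (L : Type) [Field L] [IsAlgClosed L] (φ : R →+* L) (_ : Function.Injective φ),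
        ∃ σ : ℂ →+* L, ∀ r : R, σ (r : ℂ) = φ r := by
      intro L _ _ φ hφ
      let _ : Algebra R L := φ.toAlgebra
      have : FaithfulSMul R L := (faithfulSMul_iff_algebraMap_injective R L).2 hφ
      let s : ℂ →ₐ[R] L := IsAlgClosed.lift
      exact ⟨s.toRingHom, fun r => s.commutes r⟩
    exact key ℂ φ hφ
  refine ⟨σ, fun i => ?_⟩
  have h1 := hσ (hx.1.aevalEquiv (MvPolynomial.X i))
  have h2 : ((hx.1.aevalEquiv (MvPolynomial.X i) : R) : ℂ) = x i := by simp
  rw [h2] at h1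
  rw [h1]
  simp [φ, y]

lemma exists_generic (J : Type) [Finite J] :
    ∃ t : J → ℂ, ∀ Z : Set (J → ℂ), IsClosed Z → (∀ σ : ℂ →+* ℂ, σ ∘ t ∈ Z) → Z = Set.univ := by
  classical
  let k := algebraicClosure ℚ ℂ
  obtain ⟨s, hs⟩ := exists_isTranscendenceBasis k ℂ
  have hk : Cardinal.mk k ≤ Cardinal.aleph0 := by
    have := Algebraic.countable ℚ ℂ
    have h2 : (k : Set ℂ).Countable := by
      refine this.mono ?_
      intro z hz
      exact (mem_algebraicClosure_iff.1 hz)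
    exact Cardinal.mk_le_aleph0_iff.2 h2.to_subtype
  have hC : Cardinal.aleph0 < Cardinal.mk ℂ := by
    rw [Cardinal.mk_complex]; exact Cardinal.aleph0_lt_continuum
  have hcard := IsAlgClosed.cardinal_eq_cardinal_transcendence_basis_of_aleph0_lt _ hs hk hC
  simp only [Cardinal.lift_id] at hcard
  have : Infinite s := by
    rw [Cardinal.infinite_iff, ← hcard]; exact hC.le
  obtain ⟨f⟩ : Nonempty (J ↪ s) := by
    have := Fintype.ofFinite J
    obtain ⟨g⟩ : Nonempty (J ≃ Fin (Fintype.card J)) := ⟨Fintype.equivFin J⟩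
    exact ⟨g.toEmbedding.trans (Fin.valEmbedding.trans (Infinite.natEmbedding s))⟩
  refine ⟨fun j => (f j : ℂ), fun Z hZ h => ?_⟩
  have hdense : Dense (k : Set ℂ) := by
    intro z
    rw [Metric.mem_closure_iff]
    intro ε hε
    obtain ⟨p, hp1, hp2⟩ := exists_rat_btwn (show z.re - ε/2 < z.re + ε / 2 by linarith)
    obtain ⟨q, hq1, hq2⟩ := exists_rat_btwn (show z.im - ε/2 < z.im + ε / 2 by linarith)
    refine ⟨(p : ℂ) + q * Complex.I, ?_, ?_⟩
    · have hI : Complex.I ∈ k := by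
        refine mem_algebraicClosure_iff.2 ?_
        refine ⟨Polynomial.X ^ 2 + 1, ?_, by simp⟩
        exact (Polynomial.monic_X_pow_add_C (1 : ℚ) two_ne_zero).ne_zero
      have hr : ∀ q : ℚ, (q : ℂ) ∈ k := fun q => k.algebraMap_mem q
      exact k.add_mem (hr p) (k.mul_mem (hr q) hI)
    · rw [Complex.dist_eq]
      refine (Complex.norm_le_abs_re_add_abs_im _).trans_lt ?_
      simp only [Complex.sub_re, Complex.sub_im, Complex.add_re, Complex.add_im, Complex.mul_re,
        Complex.mul_im, Complex.I_re, Complex.I_im, Complex.ratCast_re, Complex.ratCast_im]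
      have := abs_lt.2 ⟨show -(ε/2) < z.re - p by linarith, by linarith⟩
      have := abs_lt.2 ⟨show -(ε/2) < z.im - q by linarith, by linarith⟩
      ring_nf at *
      linarith
  have hd2 : Dense {v : J → ℂ | ∀ j, v j ∈ (k : Set ℂ)} := by
    have := dense_pi (Set.univ : Set J) (s := fun _ => (k : Set ℂ)) (fun _ _ => hdense)
    convert this using 1
    ext v; simp
  rw [Set.eq_univ_iff_forall]
  intro v
  let g : (J → ℂ) → (J → ℂ) := fun u j => (f j : ℂ) + u j
  have hg : Continuous g := by unfold g; fun_prop
  have hcl : IsClosed (g ⁻¹' Z) := hZ.preimage hg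
  have hsub : {v : J → ℂ | ∀ j, v j ∈ (k : Set ℂ)} ⊆ g ⁻¹' Z := by
    intro u hu
    let b : s → k := fun i => if hi : ∃ j, f j = i then ⟨u hi.choose, hu _⟩ else 0
    obtain ⟨σ, hσ⟩ := exists_shift_hom hs b
    have := h σ
    have hgu : g u = σ ∘ fun j => (f j : ℂ) := by
     ext j
     simp only [g, Function.comp]
     rw [hσ]
     have hj : ∃ j', f j' = f j := ⟨j, rfl⟩
     have : hj.choose = j := f.injective hj.choose_spec
     simp only [b, dif_pos hj]
     congr 1
     exact congrArg u this.symm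
    rw [Set.mem_preimage, hgu]
    exact this
  have hall : g ⁻¹' Z = Set.univ := by
    rw [← Set.univ_subset_iff, ← hd2.closure_eq]
    exact hcl.closure_subset_iff.2 hsub
  have := hall ▸ Set.mem_univ (fun j => v j - f j)
  simpa [g] using this

lemma isCompact_unitary (n : ℕ) :
    IsCompact {U : Matrix (Fin n) (Fin n) ℂ | U ∈ unitaryGroup (Fin n) ℂ} := by
  have h1 : IsCompact (Set.pi Set.univ (fun _ : Fin n => Set.pi Set.univ
      (fun _ : Fin n => Metric.closedBall (0 : ℂ) 1))) :=
    isCompact_univ_pi fun _ => isCompact_univ_pi fun _ => isCompact_closedBall _ _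
  refine h1.of_isClosed_subset (t := {U : Matrix (Fin n) (Fin n) ℂ | U ∈ unitaryGroup (Fin n) ℂ}) ?_ ?_
  · have : {U : Matrix (Fin n) (Fin n) ℂ | U ∈ unitaryGroup (Fin n) ℂ} =
      {U : Matrix (Fin n) (Fin n) ℂ | U * Uᴴ = 1} := by
      ext U
      exact mem_unitaryGroup_iff
    rw [this]
    exact isClosed_eq (by fun_prop) (by fun_prop)
  · intro U hU i _ j _
    simpa using entry_norm_bound_of_unitary hU i j

lemma isCompact_proj (n : ℕ) (d : ℂ) :
    IsCompact {P : Matrix (Fin n) (Fin n) ℂ | Pᴴ = P ∧ P * P = P ∧ P.trace = d} := by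
  have h1 := (isCompact_unitary n).image
    (f := fun U : Matrix (Fin n) (Fin n) ℂ => (2⁻¹ : ℂ) • (1 + U)) (by fun_prop)
  refine h1.of_isClosed_subset ?_ ?_
  · have : {P : Matrix (Fin n) (Fin n) ℂ | Pᴴ = P ∧ P * P = P ∧ P.trace = d} =
      {P : Matrix (Fin n) (Fin n) ℂ | Pᴴ = P} ∩
      ({P : Matrix (Fin n) (Fin n) ℂ | P * P = P} ∩
      {P : Matrix (Fin n) (Fin n) ℂ | P.trace = d}) := rfl
    rw [this]
    refine IsClosed.inter ?_ (IsClosed.inter ?_ ?_)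
    all_goals exact isClosed_eq (by fun_prop) (by fun_prop)
  · rintro P ⟨h1, h2, -⟩
    refine ⟨(2 : ℂ) • P - 1, ?_, ?_⟩
    · refine mem_unitaryGroup_iff.2 ?_
      rw [star_eq_conjTranspose]
      simp [h1, h2, mul_sub, sub_mul]
      module
    · simp [smul_smul]

lemma Sm_map {n : ℕ} (σ : ℂ →+* ℂ) (i : Fin n) : (Sm i).map σ = Sm i := by
  ext j k
  simp only [Sm, map_apply, diagonal_apply]
  split_ifs <;> simp

lemma exists_generic_flags (n : ℕ) (hn : 0 < n) :
    ∃ B : Fin 3 → Matrix (Fin n) (Fin n) ℂ, (∀ a, (B a).det ≠ 0) ∧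
      ∀ (w : Fin 3 → Fin n → ℝ) (c : ℝ), (∀ a i, 0 ≤ w a i) → 0 ≤ c → Feas w c → SS B w c := by
  obtain ⟨t, ht⟩ := exists_generic (Fin 3 × Fin n × Fin n)
  let Bv : (Fin 3 × Fin n × Fin n → ℂ) → Fin 3 → Matrix (Fin n) (Fin n) ℂ :=
    fun v a => of fun j k => v (a, j, k)
  have key : ∀ (N : Matrix (Fin n) (Fin n) ℂ) (C : Fin 3 → Matrix (Fin n) (Fin n) ℂ),
      ∃ P : Matrix (Fin n) (Fin n) ℂ, (Pᴴ = P ∧ P * P = P ∧ P.trace = N.rank) ∧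
        ∀ a i, (P * C a * Sm i).rank ≤ (N * Bv t a * Sm i).rank := by
    intro N
    let K : Set (Matrix (Fin n) (Fin n) ℂ) := {P | Pᴴ = P ∧ P * P = P ∧ P.trace = N.rank}
    let Z : Set (Fin 3 × Fin n × Fin n → ℂ) := {v | ∃ P ∈ K,
        ∀ a i, (P * Bv v a * Sm i).rank ≤ (N * Bv t a * Sm i).rank}
    have hZ : IsClosed Z := by
      have hK : CompactSpace K := isCompact_iff_compactSpace.1 (isCompact_proj n N.rank)
      let F : Set (K × (Fin 3 × Fin n × Fin n → ℂ)) :=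
        {q | ∀ a i, ((q.1 : Matrix (Fin n) (Fin n) ℂ) * Bv q.2 a * Sm i).rank ≤
          (N * Bv t a * Sm i).rank}
      have hF : IsClosed F := by
        have : F = ⋂ a, ⋂ i, {q : K × (Fin 3 × Fin n × Fin n → ℂ) |
            ((q.1 : Matrix (Fin n) (Fin n) ℂ) * Bv q.2 a * Sm i).rank ≤
          (N * Bv t a * Sm i).rank} := by
          ext q; simp [F]
        rw [this]
        refine isClosed_iInter fun a => isClosed_iInter fun i => ?_
        have hc : Continuous (fun q : K × (Fin 3 × Fin n × Fin n → ℂ) =>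
          (q.1 : Matrix (Fin n) (Fin n) ℂ) * Bv q.2 a * Sm i) := by
          have : Continuous (fun q : K × (Fin 3 × Fin n × Fin n → ℂ) => Bv q.2 a) := by
            refine continuous_matrix fun j k => ?_
            simp only [Bv, of_apply]
            fun_prop
          fun_prop
        exact (isClosed_rank_le _).preimage hc
      have := isClosedMap_snd_of_compactSpace F hF
      convert this using 1
      ext v
      constructor
      · rintro ⟨P, hP, h⟩
        exact ⟨(⟨P, hP⟩, v), h, rfl⟩
      · rintro ⟨⟨⟨P, hP⟩, v'⟩, h, rfl⟩
        exact ⟨P, hP, h⟩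
    have hmem : ∀ σ : ℂ →+* ℂ, σ ∘ t ∈ Z := by
      intro σ
      obtain ⟨P, Y, h1, h2, h3, h4⟩ := exists_row_proj (N.map σ)
      have h5 : P.trace = N.rank := by rw [h4, rank_map_hom]
      refine ⟨P, ⟨h1, h2, h5⟩, fun a i => ?_⟩
      have e1 : Bv (σ ∘ t) a = (Bv t a).map σ := rfl
      have e3 : P * Bv (σ ∘ t) a * Sm i = Y * (N * Bv t a * Sm i).map σ := by
        rw [Matrix.map_mul, Matrix.map_mul, Sm_map, e1, h3]
        simp only [mul_assoc]
      rw [e3, ← rank_map_hom σ (N * Bv t a * Sm i)]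
      exact rank_mul_le_right _ _
    have hall := ht Z hZ hmem
    intro C
    have hm : (fun x : Fin 3 × Fin n × Fin n => C x.1 x.2.1 x.2.2) ∈ Z := hall ▸ Set.mem_univ _
    obtain ⟨P, hP, h⟩ := hm
    exact ⟨P, hP, h⟩
  refine ⟨Bv t, ?_, ?_⟩
  · intro a hdet
    obtain ⟨P, ⟨h1, h2, h3⟩, h4⟩ := key 1 (fun _ => 1)
    have h5 := h4 a ⟨n - 1, by omega⟩
    rw [Sm_last _ (by intro j; exact Fin.le_def.2 (by simp; omega))] at h5
    simp only [mul_one, one_mul] at h5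
    have h6 := trace_le_rank (show P.IsHermitian from h1)
      (proj_psd (proj_compl h1 h2).1 (proj_compl h1 h2).2)
    rw [h3] at h6
    have h7 : (1 : Matrix (Fin n) (Fin n) ℂ).rank ≤ P.rank := by exact_mod_cast h6
    rw [rank_one] at h7
    have h8 : (Bv t a).rank = Fintype.card (Fin n) :=
      le_antisymm (rank_le_card_width _) (h7.trans h5)
    have hli : LinearIndependent ℂ (Bv t a).row := by
      rw [linearIndependent_iff_card_eq_finrank_span, ← h8, rank_eq_finrank_span_row]
      rfl
    have := (linearIndependent_rows_iff_isUnit.1 hli)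
    rw [isUnit_iff_isUnit_det, hdet] at this
    simp at this
  · intro w c hw hc hF N
    obtain ⟨U, hU, h⟩ := hF
    obtain ⟨P, ⟨h1, h2, h3⟩, h4⟩ := key N U
    have h5 := feas_proj hw hU h h1 h2
    rw [h3] at h5
    simp only [Complex.natCast_re] at h5
    refine h5.trans ?_
    refine Finset.sum_le_sum fun a _ => Finset.sum_le_sum fun i _ => ?_
    refine mul_le_mul_of_nonneg_left ?_ (hw a i)
    exact_mod_cast h4 a i
/-- Compression of a matrix to the first `i+1` coordinates, completed by the identity. -/
noncomputable def cmp {n : ℕ} (i : Fin n) (X : Matrix (Fin n) (Fin n) ℂ) :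
    Matrix (Fin n) (Fin n) ℂ := Sm i * X * Sm i + (1 - Sm i)

lemma cmp_one {n : ℕ} (i : Fin n) : cmp i 1 = 1 := by
  simp [cmp, Sm_idem]

lemma Sm_psd {n : ℕ} (i : Fin n) : (1 - Sm i).PosSemidef :=
  proj_psd (proj_compl (Sm_herm i) (Sm_idem i)).1 (proj_compl (Sm_herm i) (Sm_idem i)).2

lemma cmp_psd {n : ℕ} (i : Fin n) {X : Matrix (Fin n) (Fin n) ℂ} (hX : X.PosSemidef) :
    (cmp i X).PosSemidef := by
  have := hX.conjTranspose_mul_mul_same (Sm i)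
  rw [Sm_herm] at this
  exact this.add (Sm_psd i)

lemma cmp_conj {n : ℕ} (i : Fin n) (X : Matrix (Fin n) (Fin n) ℂ) : (cmp i X)ᴴ = cmp i Xᴴ := by
  simp [cmp, Sm_herm, mul_assoc]

lemma S_mul_compl {n : ℕ} (i : Fin n) : Sm i * (1 - Sm i) = 0 := by
  rw [mul_sub, Sm_idem, mul_one, sub_self]

lemma compl_mul_S {n : ℕ} (i : Fin n) : (1 - Sm i) * Sm i = 0 := by
  rw [sub_mul, Sm_idem, one_mul, sub_self]

lemma compl_idem {n : ℕ} (i : Fin n) : (1 - Sm i) * (1 - Sm i) = 1 - Sm i :=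
  (proj_compl (Sm_herm i) (Sm_idem i)).2

/-- multiplicativity of block forms -/
lemma cmp_mul_cmp {n : ℕ} (i : Fin n) (X Y : Matrix (Fin n) (Fin n) ℂ) :
    cmp i X * cmp i Y = cmp i (X * Sm i * Y) := by
  unfold cmp
  have h1 : Sm i * X * Sm i * (Sm i * Y * Sm i) = Sm i * (X * Sm i * Y) * Sm i := by
    calc Sm i * X * Sm i * (Sm i * Y * Sm i) = Sm i * X * (Sm i * Sm i) * Y * Sm i := by
          simp only [mul_assoc]
      _ = _ := by rw [Sm_idem]; simp only [mul_assoc]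
  have h2 : Sm i * X * Sm i * (1 - Sm i) = 0 := by
    rw [mul_assoc, S_mul_compl, mul_zero]
  have h3 : (1 - Sm i) * (Sm i * Y * Sm i) = 0 := by
    rw [← mul_assoc, ← mul_assoc, compl_mul_S, zero_mul, zero_mul]
  rw [add_mul, mul_add, mul_add, h1, h2, h3, compl_idem]
  simp

lemma cmp_mul {n : ℕ} (i : Fin n) (X T : Matrix (Fin n) (Fin n) ℂ)
    (hT : T * Sm i = Sm i * T * Sm i) :
    cmp i (Tᴴ * X * T) = (cmp i T)ᴴ * cmp i X * cmp i T := by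
  have hT' : Sm i * Tᴴ = Sm i * Tᴴ * Sm i := by
    have := congrArg conjTranspose hT
    simpa [Sm_herm, mul_assoc] using this
  have key : Sm i * (Tᴴ * X * T) * Sm i = Sm i * (Tᴴ * Sm i * X * Sm i * T) * Sm i := by
    calc Sm i * (Tᴴ * X * T) * Sm i = (Sm i * Tᴴ) * X * (T * Sm i) := by simp only [mul_assoc]
      _ = (Sm i * Tᴴ * Sm i) * X * (Sm i * T * Sm i) := by
        exact congrArg₂ (fun P Q => P * X * Q) hT' hT
      _ = _ := by simp only [mul_assoc]
  rw [cmp_conj, cmp_mul_cmp, cmp_mul_cmp]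
  exact congrArg (fun P => P + (1 - Sm i)) key

lemma eig_diag {n : ℕ} {M : Matrix (Fin n) (Fin n) ℂ} (hM : M.IsHermitian) :
    (hM.eigenvectorUnitary : Matrix (Fin n) (Fin n) ℂ)ᴴ * M *
      (hM.eigenvectorUnitary : Matrix (Fin n) (Fin n) ℂ) =
      diagonal (fun i => (hM.eigenvalues i : ℂ)) := by
  set U := (hM.eigenvectorUnitary : Matrix (Fin n) (Fin n) ℂ) with hU
  have hu : U ∈ unitaryGroup (Fin n) ℂ := hM.eigenvectorUnitary.2
  conv_lhs => rw [spectral' hM]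
  rw [← hU]
  calc Uᴴ * (U * diagonal (fun i => (hM.eigenvalues i : ℂ)) * Uᴴ) * U
          = (Uᴴ * U) * diagonal (fun i => (hM.eigenvalues i : ℂ)) * (Uᴴ * U) := by
            simp only [mul_assoc]
        _ = _ := by rw [unit2 hu]; simp

lemma trace_sq_eig {n : ℕ} {M : Matrix (Fin n) (Fin n) ℂ} (hM : M.IsHermitian) :
    ((1 - M) * (1 - M)).trace.re = ∑ j, (1 - hM.eigenvalues j) ^ 2 := by
  set U := (hM.eigenvectorUnitary : Matrix (Fin n) (Fin n) ℂ) with hU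
  have hu : U ∈ unitaryGroup (Fin n) ℂ := hM.eigenvectorUnitary.2
  have h1 : 1 - M = U * diagonal (fun i => ((1 - hM.eigenvalues i : ℝ) : ℂ)) * Uᴴ := by
    conv_lhs => rw [spectral' hM, ← hU, ← unit1 hu]
    have : diagonal (fun i => ((1 - hM.eigenvalues i : ℝ) : ℂ)) =
      1 - diagonal (fun i => (hM.eigenvalues i : ℂ)) := by
      rw [← diagonal_one, diagonal_sub]
      simp
    rw [this, mul_sub, sub_mul, mul_one]
  set D := diagonal (fun i => ((1 - hM.eigenvalues i : ℝ) : ℂ)) with hD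
  have h2 : (1 - M) * (1 - M) = U * (D * D) * Uᴴ := by
    rw [h1]
    calc U * D * Uᴴ * (U * D * Uᴴ) = U * (D * (Uᴴ * U) * D) * Uᴴ := by simp only [mul_assoc]
      _ = _ := by rw [unit2 hu, mul_one]
  rw [h2, trace_mul_cycle, unit2 hu, one_mul, hD, diagonal_mul_diagonal, trace_diagonal,
    Complex.re_sum]
  refine Finset.sum_congr rfl fun j _ => ?_
  rw [← Complex.ofReal_mul, Complex.ofReal_re, sq]

lemma trace_eig {n : ℕ} {M : Matrix (Fin n) (Fin n) ℂ} (hM : M.IsHermitian) :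
    M.trace.re = ∑ j, hM.eigenvalues j := by
  rw [hM.trace_eq_sum_eigenvalues]
  simp

lemma norm_det_eig {n : ℕ} {M : Matrix (Fin n) (Fin n) ℂ} (hM : M.IsHermitian) :
    ‖M.det‖ = ∏ j, |hM.eigenvalues j| := by
  rw [hM.det_eq_prod_eigenvalues, norm_prod]
  simp

lemma det_le_exp {n : ℕ} {M : Matrix (Fin n) (Fin n) ℂ} (hM : M.PosSemidef) :
    ‖M.det‖ ≤ Real.exp (M.trace.re - n) := by
  rw [norm_det_eig hM.1, trace_eig hM.1]
  have : (∑ j, hM.1.eigenvalues j) - n = ∑ j, (hM.1.eigenvalues j - 1) := by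
    simp [Finset.sum_sub_distrib]
  rw [this, Real.exp_sum]
  refine Finset.prod_le_prod (fun _ _ => abs_nonneg _) fun j _ => ?_
  rw [abs_of_nonneg (hM.eigenvalues_nonneg j)]
  have := Real.add_one_le_exp (hM.1.eigenvalues j - 1)
  linarith

lemma one_le_det {n : ℕ} {B : Matrix (Fin n) (Fin n) ℂ} (hB : B.PosSemidef) :
    1 ≤ ‖(1 + B).det‖ := by
  have hM : (1 + B).IsHermitian := by
    simp [IsHermitian, hB.1.eq]
  rw [norm_det_eig hM]
  have : ∀ j, 1 ≤ |hM.eigenvalues j| := by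
    intro j
    set U := (hM.eigenvectorUnitary : Matrix (Fin n) (Fin n) ℂ) with hU
    have hu : U ∈ unitaryGroup (Fin n) ℂ := hM.eigenvectorUnitary.2
    have h2 := hB.conjTranspose_mul_mul_same U
    have h3 : Uᴴ * B * U = diagonal (fun i => (hM.eigenvalues i : ℂ)) - 1 := by
      rw [← eig_diag hM, ← hU, mul_add, add_mul, mul_one, unit2 hu]
      simp
    rw [h3] at h2
    have h4 := h2.diag_nonneg (i := j)
    simp at h4
    have : (1 : ℝ) ≤ hM.eigenvalues j := by exact_mod_cast h4
    exact this.trans (le_abs_self _)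
  calc (1 : ℝ) = ∏ j : Fin n, 1 := by simp
    _ ≤ _ := Finset.prod_le_prod (fun _ _ => zero_le_one) fun j _ => this j

lemma det_mono {n : ℕ} {Z B : Matrix (Fin n) (Fin n) ℂ} (hZ : Z.det ≠ 0) (hB : B.PosSemidef) :
    ‖Z.det‖ ^ 2 ≤ ‖(Zᴴ * Z + B).det‖ := by
  have hu : IsUnit Z.det := isUnit_iff_ne_zero.2 hZ
  have huH : IsUnit Zᴴ.det := by rw [det_conjTranspose]; exact hu.star
  have h1 := hB.conjTranspose_mul_mul_same Z⁻¹
  have h2 : Zᴴ * Z + B = Zᴴ * (1 + (Z⁻¹)ᴴ * B * Z⁻¹) * Z := by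
    rw [mul_add, add_mul, mul_one]
    congr 1
    calc B = (Zᴴ * (Zᴴ)⁻¹) * B * (Z⁻¹ * Z) := by
          rw [mul_nonsing_inv _ huH, nonsing_inv_mul _ hu, one_mul, mul_one]
      _ = _ := by rw [conjTranspose_nonsing_inv]; simp only [mul_assoc]
  rw [h2, det_mul, det_mul, det_conjTranspose, norm_mul, norm_mul, norm_star]
  have := one_le_det h1
  have h0 := norm_nonneg Z.det
  nlinarith [mul_nonneg h0 h0]

lemma neg_log_det_le {n : ℕ} {Z : Matrix (Fin n) (Fin n) ℂ} (hZ : Z.IsHermitian)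
    (h : ((1 - Z) * (1 - Z)).trace.re ≤ 1 / 4) :
    Z.det ≠ 0 ∧ -Real.log ‖Z.det‖ ≤ (1 - Z).trace.re + 2 * ((1 - Z) * (1 - Z)).trace.re := by
  have h1 := trace_sq_eig hZ
  have h2 : ∀ j, (1 / 2 : ℝ) ≤ hZ.eigenvalues j := by
    intro j
    have : (1 - hZ.eigenvalues j) ^ 2 ≤ ∑ j, (1 - hZ.eigenvalues j) ^ 2 :=
      Finset.single_le_sum (f := fun j => (1 - hZ.eigenvalues j) ^ 2)
        (fun j _ => sq_nonneg _) (Finset.mem_univ j)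
    nlinarith
  have hpos : ∀ j, 0 < |hZ.eigenvalues j| := by
    intro j
    have := h2 j
    exact abs_pos.2 (by linarith)
  constructor
  · rw [← norm_ne_zero_iff, norm_det_eig hZ]
    exact (Finset.prod_pos fun j _ => hpos j).ne'
  · rw [norm_det_eig hZ, Real.log_prod (fun j _ => (hpos j).ne'), h1]
    have : (1 - Z).trace.re = ∑ j, (1 - hZ.eigenvalues j) := by
      rw [trace_sub, Complex.sub_re, trace_eig hZ]
      simp [Finset.sum_sub_distrib]
    rw [this, Finset.mul_sum, ← Finset.sum_add_distrib, ← Finset.sum_neg_distrib]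
    refine Finset.sum_le_sum fun j _ => ?_
    have hj := h2 j
    set x := hZ.eigenvalues j
    rw [abs_of_nonneg (by linarith)]
    have hx : 0 < x := by linarith
    have h3 := Real.log_le_sub_one_of_pos (inv_pos.2 hx)
    rw [Real.log_inv] at h3
    have h4 : x⁻¹ = 1 + (1 - x) + (1 - x) ^ 2 * x⁻¹ := by field_simp; ring
    have h5 : x⁻¹ ≤ 2 := by
      rw [inv_le_comm₀ hx (by norm_num)]; linarith
    nlinarith [sq_nonneg (1 - x)]

lemma exists_qr {n : ℕ} {Y : Matrix (Fin n) (Fin n) ℂ} (hY : Y.det ≠ 0) :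
    ∃ U T : Matrix (Fin n) (Fin n) ℂ, U ∈ unitaryGroup (Fin n) ℂ ∧ U = Y * T ∧
      ∀ i, T * Sm i = Sm i * T * Sm i := by
  have hinj : Function.Injective Y.mulVec := by
    apply mulVec_injective_of_isUnit
    rw [isUnit_iff_isUnit_det]
    exact isUnit_iff_ne_zero.2 hY
  have hS : (Yᴴ * Y).PosDef := PosDef.conjTranspose_mul_self _ hinj
  set L := LDL.lowerInv hS with hL
  have hLu : IsUnit L := isUnit_of_invertible L
  have hd := LDL.diag_eq_lowerInv_conj hS
  rw [← hL] at hd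
  have hpd : (L * (Yᴴ * Y) * Lᴴ).PosDef := by
    have hinj2 : Function.Injective (Y * Lᴴ).mulVec := by
      apply mulVec_injective_of_isUnit
      refine IsUnit.mul ?_ (by simpa using hLu.star)
      rw [isUnit_iff_isUnit_det]
      exact isUnit_iff_ne_zero.2 hY
    have := PosDef.conjTranspose_mul_self _ hinj2
    simpa [mul_assoc] using this
  rw [← hd, LDL.diag] at hpd
  set δ := LDL.diagEntries hS with hδ
  have hpos : ∀ i, 0 < δ i := by
    intro i
    have := hpd.diag_pos (i := i)
    simpa using this
  have hre : ∀ i, 0 < (δ i).re ∧ δ i = ((δ i).re : ℂ) := by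
    intro i
    have := Complex.lt_def.1 (hpos i)
    refine ⟨this.1, ?_⟩
    apply Complex.ext <;> simp [← this.2]
  let q : Fin n → ℂ := fun i => ((Real.sqrt (δ i).re)⁻¹ : ℝ)
  have hq : ∀ i, q i * δ i * q i = 1 := by
    intro i
    rw [(hre i).2]
    simp only [q]
    rw [← Complex.ofReal_mul, ← Complex.ofReal_mul]
    have h1 := Real.mul_self_sqrt (hre i).1.le
    have h2 := Real.sqrt_pos.2 (hre i).1
    norm_cast
    field_simp
    nlinarith
  refine ⟨Y * (Lᴴ * diagonal q), Lᴴ * diagonal q, ?_, rfl, ?_⟩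
  · rw [mem_unitaryGroup_iff', star_eq_conjTranspose]
    have hqs : (diagonal q)ᴴ = diagonal q := by
      rw [diagonal_conjTranspose]; congr 1; ext i; simp [q]
    calc (Y * (Lᴴ * diagonal q))ᴴ * (Y * (Lᴴ * diagonal q))
        = diagonal q * (L * (Yᴴ * Y) * Lᴴ) * diagonal q := by
          simp only [conjTranspose_mul, conjTranspose_conjTranspose, hqs, mul_assoc]
      _ = 1 := by
          rw [← hd, LDL.diag, diagonal_mul_diagonal, diagonal_mul_diagonal, ← diagonal_one]
          congr 1
          ext i
          exact hq i
  · intro i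
    ext j k
    simp only [Sm, mul_diagonal, diagonal_mul, conjTranspose_apply]
    by_cases hk : k ≤ i
    · by_cases hj : j ≤ i
      · simp [hj]
      · have : L k j = 0 := LDL.lowerInv_triangular hS (lt_of_le_of_lt hk (not_le.1 hj))
        simp [this]
    · simp [hk]

lemma cmp_lower {n : ℕ} (i : Fin n) (Y : Matrix (Fin n) (Fin n) ℂ) (hY : (cmp i Y).det ≠ 0)
    (g : Fin n → ℝ) :
    (∑ j, if j ≤ i then g j else 0) + 2 * Real.log ‖(cmp i Y).det‖ ≤
      Real.log ‖(cmp i (Yᴴ * diagonal (fun j => (Real.exp (g j) : ℂ)) * Y)).det‖ := by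
  set D : Matrix (Fin n) (Fin n) ℂ := diagonal (fun j => (Real.exp (g j) : ℂ)) with hD
  set E : Matrix (Fin n) (Fin n) ℂ :=
    diagonal (fun j => if j ≤ i then (Real.exp (g j / 2) : ℂ) else 1) with hE
  have hEE : Eᴴ * E = cmp i D := by
    rw [hE, hD, diagonal_conjTranspose, diagonal_mul_diagonal, cmp, Sm, diagonal_mul_diagonal,
      diagonal_mul_diagonal, ← diagonal_one, diagonal_sub, diagonal_add]
    congr 1
    ext j
    by_cases h : j ≤ i
    · simp only [Pi.star_apply, h, if_true, Complex.star_def, Complex.conj_ofReal]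
      rw [← Complex.ofReal_mul, ← Real.exp_add]
      simp
    · simp [h]
  have hB : (Sm i * Yᴴ * (D - Sm i * D * Sm i) * (Y * Sm i)).PosSemidef := by
    have h1 : (D - Sm i * D * Sm i).PosSemidef := by
      rw [hD, Sm, diagonal_mul_diagonal, diagonal_mul_diagonal, diagonal_sub]
      refine PosSemidef.diagonal ?_
      intro j
      by_cases h : j ≤ i
      · simp [h]
      · simp only [h, Pi.zero_apply, if_false]
        simp only [zero_mul, sub_zero]
        exact_mod_cast (Real.exp_pos _).le
    have := h1.conjTranspose_mul_mul_same (Y * Sm i)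
    rwa [conjTranspose_mul, Sm_herm] at this
  have hdE : ‖E.det‖ = Real.exp ((∑ j, if j ≤ i then g j else 0) / 2) := by
    rw [hE, det_diagonal, norm_prod, Finset.sum_div, Real.exp_sum]
    refine Finset.prod_congr rfl fun j _ => ?_
    split_ifs
    · rw [Complex.norm_real, Real.norm_of_nonneg (Real.exp_pos _).le]
    · simp
  have hdE0 : E.det ≠ 0 := by
    rw [← norm_ne_zero_iff, hdE]; exact (Real.exp_pos _).ne'
  have hZ : (E * cmp i Y).det ≠ 0 := by
    rw [det_mul]; exact mul_ne_zero hdE0 hY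
  have key := det_mono hZ hB
  have hsum : (E * cmp i Y)ᴴ * (E * cmp i Y) + Sm i * Yᴴ * (D - Sm i * D * Sm i) * (Y * Sm i)
      = cmp i (Yᴴ * D * Y) := by
    have e1 : (E * cmp i Y)ᴴ * (E * cmp i Y) = cmp i (Yᴴ * Sm i * D * Sm i * Y) := by
      calc (E * cmp i Y)ᴴ * (E * cmp i Y) = (cmp i Y)ᴴ * (Eᴴ * E) * cmp i Y := by
            simp only [conjTranspose_mul, mul_assoc]
        _ = _ := by rw [hEE, cmp_conj, cmp_mul_cmp, cmp_mul_cmp]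
    rw [e1, cmp, cmp, mul_sub, sub_mul]
    simp only [mul_assoc]
    abel
  rw [hsum, det_mul, norm_mul, hdE] at key
  have hp : 0 < ‖(cmp i Y).det‖ := norm_pos_iff.2 hY
  have := Real.log_le_log (by positivity) key
  rw [Real.log_pow, Real.log_mul (Real.exp_pos _).ne' hp.ne', Real.log_exp] at this
  push_cast at this
  linarith

/-- Successive differences of a vector. -/
noncomputable def wt {n : ℕ} (h : Fin n → ℝ) (k : Fin n) : ℝ :=
  h k - if hk : (k : ℕ) + 1 < n then h ⟨k + 1, hk⟩ else 0

lemma sum_wt {n : ℕ} (h : Fin n → ℝ) (j : Fin n) :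
    (∑ k, if j ≤ k then wt h k else 0) = h j := by
  let f : ℕ → ℝ := fun m => if hm : m < n then h ⟨m, hm⟩ else 0
  have hf : ∀ k : Fin n, wt h k = f k - f (k + 1) := by
    intro k
    simp [wt, f]
  have h1 : (∑ k, if j ≤ k then wt h k else 0) =
      ∑ k ∈ Finset.range n, if (j : ℕ) ≤ k then f k - f (k + 1) else 0 := by
    rw [← Fin.sum_univ_eq_sum_range (fun k => if (j : ℕ) ≤ k then f k - f (k + 1) else 0)]
    refine Finset.sum_congr rfl fun k _ => ?_
    rw [hf]
    exact if_congr Fin.le_def rfl rfl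
  have h2 : ∀ m, (∑ k ∈ Finset.range m, if (j : ℕ) ≤ k then f k - f (k + 1) else 0) =
      if (j : ℕ) ≤ m then f j - f m else 0 := by
    intro m
    induction m with
    | zero =>
      split_ifs with h
      · have : (j : ℕ) = 0 := by omega
        simp [this]
      · simp
    | succ m ih =>
      rw [Finset.sum_range_succ, ih]
      by_cases h : (j : ℕ) ≤ m
      · simp [h, Nat.le_succ_of_le h]
      · by_cases h' : (j : ℕ) = m + 1
        · simp [h']
        · have : ¬ (j : ℕ) ≤ m + 1 := by omega
          simp [h, this]
  rw [h1, h2]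
  simp [f, j.2.le]

lemma sum_wt_mul {n : ℕ} (h x : Fin n → ℝ) :
    ∑ j, h j * x j = ∑ k, wt h k * ∑ j, if j ≤ k then x j else 0 := by
  simp_rw [Finset.mul_sum]
  rw [Finset.sum_comm]
  refine Finset.sum_congr rfl fun j _ => ?_
  conv_lhs => rw [← sum_wt h j, Finset.sum_mul]
  refine Finset.sum_congr rfl fun k _ => ?_
  split_ifs <;> simp

lemma wt_nonneg_of_lt {n : ℕ} {h : Fin n → ℝ} (hh : Antitone h) {k : Fin n}
    (hk : (k : ℕ) + 1 < n) : 0 ≤ wt h k := by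
  rw [wt, dif_pos hk, sub_nonneg]
  apply hh
  rw [Fin.le_def]; simp

lemma wt_nonneg {n : ℕ} {h : Fin n → ℝ} (hh : Antitone h) (h0 : ∀ k, 0 ≤ h k) (k : Fin n) :
    0 ≤ wt h k := by
  by_cases hk : (k : ℕ) + 1 < n
  · exact wt_nonneg_of_lt hh hk
  · rw [wt, dif_neg hk, sub_zero]; exact h0 k

lemma wt_comb {n : ℕ} (s t : ℝ) (h h' : Fin n → ℝ) (k : Fin n) :
    wt (fun j => s * h j + t * h' j) k = s * wt h k + t * wt h' k := by
  unfold wt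
  split_ifs <;> ring

lemma rank_Sm {n : ℕ} (i : Fin n) : (Sm i).rank = (i : ℕ) + 1 := by
  rw [Sm, rank_diagonal, Fintype.card_subtype]
  have : (Finset.univ.filter (fun j => (if j ≤ i then (1 : ℂ) else 0) ≠ 0)) = Finset.Iic i := by
    ext; simp
  rw [this]
  simp

lemma exists_pivots {n : ℕ} {V : Type*} [AddCommGroup V] [Module ℂ V] (v : Fin n → V) :
    ∃ b : Set (Fin n), LinearIndepOn ℂ v b ∧
      ∀ j, v j ∈ Submodule.span ℂ (v '' (b ∩ Set.Iic j)) := by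
  have claim : ∀ m ≤ n, ∃ b : Set (Fin n), (∀ j ∈ b, (j : ℕ) < m) ∧ LinearIndepOn ℂ v b ∧
      ∀ j : Fin n, (j : ℕ) < m → v j ∈ Submodule.span ℂ (v '' (b ∩ Set.Iic j)) := by
    intro m
    induction m with
    | zero => intro _; exact ⟨∅, by simp, linearIndepOn_empty _ _, by simp⟩
    | succ m ih =>
      intro hm
      obtain ⟨b, hb, hli, hsp⟩ := ih (by omega)
      let j0 : Fin n := ⟨m, hm⟩
      have hb0 : b ⊆ Set.Iic j0 := fun j hj => by
        have := hb j hj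
        rw [Set.mem_Iic, Fin.le_def]; exact this.le
      by_cases hmem : v j0 ∈ Submodule.span ℂ (v '' b)
      · refine ⟨b, fun j hj => (hb j hj).trans (Nat.lt_succ_self _), hli, fun j hj => ?_⟩
        by_cases h : (j : ℕ) < m
        · exact hsp j h
        · have : j = j0 := Fin.ext (by simp only [j0]; omega)
          rw [this, Set.inter_eq_left.2 hb0]
          exact hmem
      · refine ⟨insert j0 b, ?_, ?_, fun j hj => ?_⟩
        · intro j hj
          rcases hj with rfl | hj
          · simp [j0]
          · exact (hb j hj).trans (Nat.lt_succ_self _)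
        · have : j0 ∉ b := fun h => by have := hb j0 h; simp [j0] at this
          rw [linearIndepOn_insert this]
          exact ⟨hli, hmem⟩
        · by_cases h : (j : ℕ) < m
          · refine Submodule.span_mono (Set.image_mono ?_) (hsp j h)
            exact Set.inter_subset_inter_left _ (Set.subset_insert _ _)
          · have : j = j0 := Fin.ext (by simp only [j0]; omega)
            rw [this]
            apply Submodule.subset_span
            exact ⟨j0, ⟨Set.mem_insert _ _, Set.mem_Iic.2 le_rfl⟩, rfl⟩
  obtain ⟨b, -, h1, h2⟩ := claim n le_rfl
  exact ⟨b, h1, fun j => h2 j j.2⟩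

lemma pivot {n : ℕ} {X : Matrix (Fin n) (Fin n) ℂ} (hX : X.det ≠ 0) (i : Fin n) :
    ∃ e : Equiv.Perm (Fin n), (cmp i (X.submatrix e id)).det ≠ 0 ∧
      ∀ k, (Sm k * X * Sm i).rank ≤ (Finset.univ.filter (fun j => j ≤ i ∧ e j ≤ k)).card := by
  classical
  let v : Fin n → (Fin n → ℂ) := (X * Sm i).row
  obtain ⟨b, hli, hsp⟩ := exists_pivots v
  have hrank : (X * Sm i).rank = (i : ℕ) + 1 := by
    rw [rank_mul_eq_right_of_isUnit_det _ _ (isUnit_iff_ne_zero.2 hX), rank_Sm]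
  have hk : ∀ k, (Sm k * X * Sm i).rank ≤ (Finset.univ.filter (fun j => j ∈ b ∧ j ≤ k)).card := by
    intro k
    rw [rank_eq_finrank_span_row]
    have h1 : Submodule.span ℂ (Set.range (Sm k * X * Sm i).row) ≤
        Submodule.span ℂ (((Finset.univ.filter (fun j => j ∈ b ∧ j ≤ k)).image v :
          Finset (Fin n → ℂ)) : Set (Fin n → ℂ)) := by
      rw [Submodule.span_le]
      rintro _ ⟨j, rfl⟩
      have hrow : (Sm k * X * Sm i).row j = (if j ≤ k then (1 : ℂ) else 0) • v j := by
        ext l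
        simp only [v, row, mul_assoc, Sm, diagonal_mul, Pi.smul_apply, smul_eq_mul]
      rw [hrow]
      by_cases hjk : j ≤ k
      · rw [if_pos hjk, one_smul]
        refine Submodule.span_mono ?_ (hsp j)
        rintro _ ⟨l, ⟨hl, hlj⟩, rfl⟩
        simp only [Finset.coe_image, Finset.coe_filter, Finset.mem_univ, true_and]
        exact ⟨l, ⟨hl, le_trans hlj hjk⟩, rfl⟩
      · rw [if_neg hjk, zero_smul]; exact Submodule.zero_mem _
    refine (Submodule.finrank_mono h1).trans ((finrank_span_finset_le_card _).trans ?_)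
    exact Finset.card_image_le
  have hcard : Fintype.card b = (i : ℕ) + 1 := by
    apply le_antisymm
    · have hsub : LinearIndependent ℂ (fun j : b => v j) := hli
      have := finrank_span_eq_card hsub
      rw [← this, ← hrank, rank_eq_finrank_span_row]
      refine Submodule.finrank_mono (Submodule.span_mono ?_)
      rintro _ ⟨j, rfl⟩
      exact ⟨j, rfl⟩
    · have hn : 0 < n := i.pos
      have := hk ⟨n - 1, by omega⟩
      have hlast : Sm (⟨n - 1, by omega⟩ : Fin n) = 1 := Sm_last _ (fun j => by
        rw [Fin.le_def]; simp only; omega)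
      rw [hlast, one_mul, hrank] at this
      refine this.trans ?_
      rw [← Set.toFinset_card]
      apply Finset.card_le_card
      intro j hj
      simp at hj
      simpa using hj.1
  have hcard2 : Fintype.card {j : Fin n // j ≤ i} = Fintype.card {j : Fin n // j ∈ b} := by
    have h0 : Fintype.card {j : Fin n // j ∈ b} = Fintype.card b := Fintype.card_congr (Equiv.refl _)
    rw [h0, hcard, Fintype.card_subtype]
    have : (Finset.univ.filter (fun j => j ≤ i)) = Finset.Iic i := by ext; simp
    simp [this]
  let e0 : {j : Fin n // j ≤ i} ≃ {j : Fin n // j ∈ b} := Fintype.equivOfCardEq hcard2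
  let e := e0.extendSubtype
  have he1 : ∀ j, j ≤ i → e j ∈ b := fun j hj => e0.extendSubtype_mem j hj
  have he2 : ∀ j, ¬ j ≤ i → e j ∉ b := fun j hj => e0.extendSubtype_not_mem j hj
  refine ⟨e, ?_, fun k => (hk k).trans ?_⟩
  · intro h0
    obtain ⟨u, hu0, hu⟩ := exists_vecMul_eq_zero_iff.2 h0
    have hent : ∀ l, (∑ j, (if j ≤ i then u j * X (e j) l else 0)) * (if l ≤ i then 1 else 0)
        + u l * (1 - if l ≤ i then 1 else 0) = 0 := by
      intro l
      have := congrFun hu l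
      rw [cmp, vecMul_add, Pi.add_apply] at this
      rw [Pi.zero_apply] at this
      refine Eq.trans ?_ this
      congr 1
      · simp only [vecMul, dotProduct, Sm, mul_diagonal, diagonal_mul, submatrix_apply, id]
        rw [Finset.sum_mul]
        refine Finset.sum_congr rfl fun j _ => ?_
        split_ifs <;> simp
      · rw [Sm, ← diagonal_one, diagonal_sub, vecMul_diagonal]
    have hgt : ∀ l, ¬ l ≤ i → u l = 0 := by
      intro l hl
      have := hent l
      simpa [hl] using this
    have hli2 : LinearIndependent ℂ (fun j : {j : Fin n // j ≤ i} => v (e j)) := by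
      have hsub : LinearIndependent ℂ (fun j : b => v j) := hli
      exact hsub.comp (fun j : {j : Fin n // j ≤ i} => (⟨e j, he1 j j.2⟩ : b))
        (fun x y hxy => by
          have : e x = e y := congrArg Subtype.val hxy
          exact Subtype.ext (e.injective this))
    rw [Fintype.linearIndependent_iff] at hli2
    have hle := hli2 (fun j => u j) (by
      ext l
      simp only [Finset.sum_apply, Pi.smul_apply, smul_eq_mul, Pi.zero_apply, v, row, Sm,
        mul_diagonal]
      by_cases hl : l ≤ i
      · have := hent l
        simp only [hl, if_true, mul_one, sub_self, mul_zero, add_zero] at this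
        simp only [hl, if_true, mul_one]
        refine Eq.trans ?_ this
        rw [← Finset.sum_filter]
        exact (Finset.sum_subtype (Finset.univ.filter (fun j => j ≤ i)) (by simp)
          (fun j => u j * X (e j) l)).symm
      · simp [hl])
    apply hu0
    ext l
    by_cases hl : l ≤ i
    · exact hle ⟨l, hl⟩
    · exact hgt l hl
  · refine Finset.card_le_card_of_injOn (fun j => e.symm j) ?_ (fun x _ y _ h => e.symm.injective h)
    intro j hj
    simp at hj ⊢
    refine ⟨?_, hj.2⟩
    by_contra hc
    have := he2 _ hc
    simp at this
    exact this hj.1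

/-- The Kempf-Ness type functional. -/
noncomputable def psi {n : ℕ} (B : Fin 3 → Matrix (Fin n) (Fin n) ℂ) (w : Fin 3 → Fin n → ℝ)
    (c : ℝ) (H : Matrix (Fin n) (Fin n) ℂ) : ℝ :=
  ∑ a, ∑ i, w a i * Real.log ‖(cmp i ((B a)ᴴ * H * B a)).det‖ - c * Real.log ‖H.det‖

lemma comb_ineq {n : ℕ} {w : Fin 3 → Fin n → ℝ} {c : ℝ}
    (htr : ∑ a, ∑ i : Fin n, w a i * ((i : ℝ) + 1) = c * n)
    (e : Fin 3 → Fin n → Equiv.Perm (Fin n))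
    (hcnt : ∀ k : Fin n, c * ((k : ℝ) + 1) ≤ ∑ a, ∑ i, w a i *
      ((Finset.univ.filter (fun j => j ≤ i ∧ e a i j ≤ k)).card : ℝ))
    {h : Fin n → ℝ} (hh : Antitone h) :
    c * ∑ j, h j ≤ ∑ a, ∑ i, w a i * ∑ j, if j ≤ i then h (e a i j) else 0 := by
  have h1 : ∀ a i, (∑ j, if j ≤ i then h (e a i j) else 0) = ∑ k, wt h k *
      ((Finset.univ.filter (fun j => j ≤ i ∧ e a i j ≤ k)).card : ℝ) := by
    intro a i
    have s1 : (∑ j, if j ≤ i then h (e a i j) else 0) =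
        ∑ m, h m * (if (e a i).symm m ≤ i then 1 else 0) := by
      rw [← Equiv.sum_comp (e a i) (fun m => h m * (if (e a i).symm m ≤ i then 1 else 0))]
      simp
    rw [s1, sum_wt_mul]
    refine Finset.sum_congr rfl fun k _ => ?_
    congr 1
    rw [← Equiv.sum_comp (e a i), Finset.card_filter]
    push_cast
    refine Finset.sum_congr rfl fun j _ => ?_
    simp only [Equiv.symm_apply_apply]
    by_cases q1 : j ≤ i <;> by_cases q2 : e a i j ≤ k <;> simp [q1, q2]
  have h2 : ∑ j, h j = ∑ k : Fin n, wt h k * ((k : ℝ) + 1) := by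
    have := sum_wt_mul h (fun _ => 1)
    simp only [mul_one] at this
    rw [this]
    refine Finset.sum_congr rfl fun k _ => ?_
    rw [← Finset.sum_filter]
    have : (Finset.univ.filter (fun j => j ≤ k)) = Finset.Iic k := by ext; simp
    simp [this]
  have h3 : ∑ a, ∑ i, w a i * (∑ j, if j ≤ i then h (e a i j) else 0) =
      ∑ k, wt h k * ∑ a, ∑ i, w a i *
        ((Finset.univ.filter (fun j => j ≤ i ∧ e a i j ≤ k)).card : ℝ) := by
    simp_rw [h1, Finset.mul_sum]
    have : ∀ a, (∑ i, ∑ k, w a i * (wt h k *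
        ((Finset.univ.filter (fun j => j ≤ i ∧ e a i j ≤ k)).card : ℝ))) =
        ∑ k, ∑ i, wt h k * (w a i *
        ((Finset.univ.filter (fun j => j ≤ i ∧ e a i j ≤ k)).card : ℝ)) := by
      intro a
      rw [Finset.sum_comm]
      refine Finset.sum_congr rfl fun k _ => Finset.sum_congr rfl fun i _ => ?_
      ring
    simp_rw [this]
    rw [Finset.sum_comm]
  rw [h3, h2, Finset.mul_sum]
  refine Finset.sum_le_sum fun k _ => ?_
  by_cases hk : (k : ℕ) + 1 < n
  · have := mul_le_mul_of_nonneg_left (hcnt k) (wt_nonneg_of_lt hh hk)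
    linarith
  · have hkn : (k : ℕ) + 1 = n := by have := k.2; omega
    have hkr : (k : ℝ) + 1 = n := by exact_mod_cast hkn
    have hc : ∀ a (i : Fin n),
        ((Finset.univ.filter (fun j => j ≤ i ∧ e a i j ≤ k)).card : ℝ) = (i : ℝ) + 1 := by
      intro a i
      have : (Finset.univ.filter (fun j => j ≤ i ∧ e a i j ≤ k)) = Finset.Iic i := by
        ext j
        simp only [Finset.mem_filter, Finset.mem_univ, true_and, Finset.mem_Iic, and_iff_left_iff_imp]
        intro _
        rw [Fin.le_def]
        have := (e a i j).2
        omega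
      rw [this]
      simp
    simp_rw [hc]
    rw [htr, hkr]
    linarith

lemma conj_perm {n : ℕ} (Y : Matrix (Fin n) (Fin n) ℂ) (e : Equiv.Perm (Fin n)) (d : Fin n → ℂ) :
    (Y.submatrix e id)ᴴ * diagonal (fun j => d (e j)) * Y.submatrix e id =
      Yᴴ * diagonal d * Y := by
  have h1 : diagonal (fun j => d (e j)) = (diagonal d).submatrix e e := by
    rw [submatrix_diagonal_equiv]; rfl
  rw [h1, conjTranspose_submatrix, submatrix_mul_equiv, submatrix_mul_equiv, submatrix_id_id]

lemma continuous_cmp_det {n : ℕ} (i : Fin n) :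
    Continuous fun X : Matrix (Fin n) (Fin n) ℂ => (cmp i X).det := by
  refine Continuous.matrix_det ?_
  exact ((continuous_const.matrix_mul continuous_id).matrix_mul continuous_const).add
    continuous_const

lemma psi_local {n : ℕ} {B : Fin 3 → Matrix (Fin n) (Fin n) ℂ} {w : Fin 3 → Fin n → ℝ}
    {c : ℝ} (hB : ∀ a, (B a).det ≠ 0) (hw : ∀ a i, 0 ≤ w a i) (hSS : SS B w c)
    (htr : ∑ a, ∑ i : Fin n, w a i * ((i : ℝ) + 1) = c * n)
    {U0 : Matrix (Fin n) (Fin n) ℂ} (hU0 : U0 ∈ unitaryGroup (Fin n) ℂ) :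
    ∃ C : ℝ, ∀ᶠ U in nhds U0, U ∈ unitaryGroup (Fin n) ℂ → ∀ h : Fin n → ℝ, Antitone h →
      -C ≤ psi B w c (Uᴴ * diagonal (fun j => (Real.exp (h j) : ℂ)) * U) := by
  have hdU : U0.det ≠ 0 := by
    intro h
    have := congrArg det (unit1 hU0)
    rw [det_mul, h] at this
    simp at this
  have hX : ∀ a, (U0 * B a).det ≠ 0 := fun a => by
    rw [det_mul]; exact mul_ne_zero hdU (hB a)
  choose e he1 he2 using fun a => pivot (hX a)
  let δ : Fin 3 → Fin n → ℝ := fun a i => ‖(cmp i ((U0 * B a).submatrix (e a i) id)).det‖ / 2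
  have hδ : ∀ a i, 0 < δ a i := fun a i => half_pos (norm_pos_iff.2 (he1 a i))
  have hcnt : ∀ k : Fin n, c * ((k : ℝ) + 1) ≤ ∑ a, ∑ i, w a i *
      ((Finset.univ.filter (fun j => j ≤ i ∧ e a i j ≤ k)).card : ℝ) := by
    intro k
    have h1 := hSS (Sm k * U0)
    rw [rank_mul_eq_left_of_isUnit_det _ _ (isUnit_iff_ne_zero.2 hdU), rank_Sm] at h1
    push_cast at h1
    refine h1.trans ?_
    refine Finset.sum_le_sum fun a _ => Finset.sum_le_sum fun i _ => ?_
    refine mul_le_mul_of_nonneg_left ?_ (hw a i)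
    rw [mul_assoc (Sm k) U0]
    exact_mod_cast he2 a i k
  refine ⟨-∑ a, ∑ i, w a i * (2 * Real.log (δ a i)), ?_⟩
  have hev : ∀ᶠ U in nhds U0, ∀ a i, δ a i < ‖(cmp i ((U * B a).submatrix (e a i) id)).det‖ := by
    rw [Filter.eventually_all]
    intro a
    rw [Filter.eventually_all]
    intro i
    have hcont : Continuous fun U : Matrix (Fin n) (Fin n) ℂ =>
        ‖(cmp i ((U * B a).submatrix (e a i) id)).det‖ := by
      exact ((continuous_cmp_det i).comp
        ((continuous_id.matrix_mul continuous_const).matrix_submatrix _ _)).norm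
    refine hcont.continuousAt.eventually_const_lt ?_
    exact half_lt_self (norm_pos_iff.2 (he1 a i))
  filter_upwards [hev] with U hU hUu h hh
  have hdet : Real.log ‖(Uᴴ * diagonal (fun j => (Real.exp (h j) : ℂ)) * U).det‖ = ∑ j, h j := by
    rw [det_mul_comm, ← mul_assoc, unit1 hUu, one_mul, det_diagonal, norm_prod, Real.log_prod]
    · refine Finset.sum_congr rfl fun j _ => ?_
      rw [Complex.norm_real, Real.norm_of_nonneg (Real.exp_pos _).le, Real.log_exp]
    · intro j _
      rw [Complex.norm_real]
      exact norm_ne_zero_iff.2 (Real.exp_pos _).ne'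
  have hlow : ∀ a i, (∑ j, if j ≤ i then h (e a i j) else 0) + 2 * Real.log (δ a i) ≤
      Real.log ‖(cmp i ((B a)ᴴ * (Uᴴ * diagonal (fun j => (Real.exp (h j) : ℂ)) * U) * B a)).det‖ := by
    intro a i
    have hpos := (hδ a i).trans (hU a i)
    have h1 := cmp_lower i ((U * B a).submatrix (e a i) id) (norm_pos_iff.1 hpos)
      (fun j => h (e a i j))
    have h2 := conj_perm (U * B a) (e a i) (fun j => (Real.exp (h j) : ℂ))
    rw [h2] at h1
    have h3 : (U * B a)ᴴ * diagonal (fun j => (Real.exp (h j) : ℂ)) * (U * B a) =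
        (B a)ᴴ * (Uᴴ * diagonal (fun j => (Real.exp (h j) : ℂ)) * U) * B a := by
      simp only [conjTranspose_mul, mul_assoc]
    rw [h3] at h1
    refine le_trans ?_ h1
    have := Real.log_le_log (hδ a i) (hU a i).le
    linarith
  have hcomb := comb_ineq htr e hcnt hh
  have hsum : ∑ a, ∑ i, w a i * ((∑ j, if j ≤ i then h (e a i j) else 0) + 2 * Real.log (δ a i)) ≤
      ∑ a, ∑ i, w a i * Real.log
        ‖(cmp i ((B a)ᴴ * (Uᴴ * diagonal (fun j => (Real.exp (h j) : ℂ)) * U) * B a)).det‖ :=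
    Finset.sum_le_sum fun a _ => Finset.sum_le_sum fun i _ =>
      mul_le_mul_of_nonneg_left (hlow a i) (hw a i)
  simp_rw [mul_add, Finset.sum_add_distrib] at hsum
  rw [psi, hdet]
  linarith

lemma psi_bdd {n : ℕ} {B : Fin 3 → Matrix (Fin n) (Fin n) ℂ} {w : Fin 3 → Fin n → ℝ}
    {c : ℝ} (hB : ∀ a, (B a).det ≠ 0) (hw : ∀ a i, 0 ≤ w a i) (hSS : SS B w c)
    (htr : ∑ a, ∑ i : Fin n, w a i * ((i : ℝ) + 1) = c * n) :
    ∃ C : ℝ, ∀ U ∈ unitaryGroup (Fin n) ℂ, ∀ h : Fin n → ℝ, Antitone h →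
      -C ≤ psi B w c (Uᴴ * diagonal (fun j => (Real.exp (h j) : ℂ)) * U) := by
  have := (isCompact_unitary n).induction_on
    (p := fun s => ∃ C : ℝ, ∀ U ∈ s, U ∈ unitaryGroup (Fin n) ℂ → ∀ h : Fin n → ℝ, Antitone h →
      -C ≤ psi B w c (Uᴴ * diagonal (fun j => (Real.exp (h j) : ℂ)) * U))
    ⟨0, by simp⟩ ?_ ?_ ?_
  · obtain ⟨C, hC⟩ := this
    exact ⟨C, fun U hU => hC U hU hU⟩
  · rintro s t hst ⟨C, hC⟩
    exact ⟨C, fun U hU => hC U (hst hU)⟩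
  · rintro s t ⟨C, hC⟩ ⟨C', hC'⟩
    refine ⟨max C C', ?_⟩
    rintro U (hU | hU) hu h hh
    · exact (neg_le_neg (le_max_left _ _)).trans (hC U hU hu h hh)
    · exact (neg_le_neg (le_max_right _ _)).trans (hC' U hU hu h hh)
  · intro U0 hU0
    obtain ⟨C, hC⟩ := psi_local hB hw hSS htr hU0
    exact ⟨_, mem_nhdsWithin_of_mem_nhds hC, C, fun U hU => hU⟩

lemma eigsDesc_antitone {n : ℕ} {A : Matrix (Fin n) (Fin n) ℂ} (hA : A.IsHermitian) :
    Antitone (eigsDesc hA) := by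
  intro i j hij
  exact Tuple.monotone_sort hA.eigenvalues (Fin.rev_le_rev.2 hij)

lemma spectral_desc {n : ℕ} {A : Matrix (Fin n) (Fin n) ℂ} (hA : A.IsHermitian) :
    ∃ U ∈ unitaryGroup (Fin n) ℂ, A = U * diagonal (fun i => (eigsDesc hA i : ℂ)) * Uᴴ := by
  set V := (hA.eigenvectorUnitary : Matrix (Fin n) (Fin n) ℂ) with hV
  have hv : V ∈ unitaryGroup (Fin n) ℂ := hA.eigenvectorUnitary.2
  let e : Equiv.Perm (Fin n) := Fin.revPerm.trans (Tuple.sort hA.eigenvalues)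
  refine ⟨V.submatrix id e, ?_, ?_⟩
  · rw [mem_unitaryGroup_iff, star_eq_conjTranspose, conjTranspose_submatrix, submatrix_mul_equiv,
      unit1 hv, submatrix_id_id]
  · conv_lhs => rw [spectral' hA, ← hV]
    have h1 : diagonal (fun i => (eigsDesc hA i : ℂ)) =
        (diagonal (fun i => (hA.eigenvalues i : ℂ))).submatrix e e := by
      rw [submatrix_diagonal_equiv]; rfl
    rw [h1, conjTranspose_submatrix, submatrix_mul_equiv, submatrix_mul_equiv, submatrix_id_id]

/-- Behaviour of the compressed determinants under a Gram-Schmidt change of flag basis. -/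
lemma qr_det {n : ℕ} {Y U T : Matrix (Fin n) (Fin n) ℂ} (hU : U = Y * T) (i : Fin n)
    (hT : T * Sm i = Sm i * T * Sm i) (M : Matrix (Fin n) (Fin n) ℂ) :
    ‖(cmp i (Uᴴ * M * U)).det‖ = ‖(cmp i T).det‖ ^ 2 * ‖(cmp i (Yᴴ * M * Y)).det‖ := by
  have h1 : Uᴴ * M * U = Tᴴ * (Yᴴ * M * Y) * T := by
    rw [hU]; simp only [conjTranspose_mul, mul_assoc]
  rw [h1, cmp_mul i _ T hT, det_mul, det_mul, det_conjTranspose, norm_mul, norm_mul, norm_star]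
  ring

lemma qr_one {n : ℕ} {Y U T : Matrix (Fin n) (Fin n) ℂ} (hUu : U ∈ unitaryGroup (Fin n) ℂ)
    (hU : U = Y * T) (i : Fin n) (hT : T * Sm i = Sm i * T * Sm i) :
    1 = ‖(cmp i T).det‖ ^ 2 * ‖(cmp i (Yᴴ * Y)).det‖ := by
  have := qr_det hU i hT 1
  rw [mul_one, mul_one, unit2 hUu, cmp_one, det_one, norm_one] at this
  exact this

lemma cmp_det_ne {n : ℕ} {Y : Matrix (Fin n) (Fin n) ℂ} (hY : Y.det ≠ 0) (i : Fin n) :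
    ‖(cmp i (Yᴴ * Y)).det‖ ≠ 0 := by
  obtain ⟨U, T, hUu, hU, hT⟩ := exists_qr hY
  have := qr_one hUu hU i (hT i)
  intro h
  rw [h, mul_zero] at this
  exact one_ne_zero this

lemma log_cmp_step {n : ℕ} {Y U T Z : Matrix (Fin n) (Fin n) ℂ} (hY : Y.det ≠ 0)
    (hUu : U ∈ unitaryGroup (Fin n) ℂ) (hU : U = Y * T) (i : Fin n)
    (hT : T * Sm i = Sm i * T * Sm i) (hZ : Zᴴ = Z) (hZd : Z.det ≠ 0) :
    Real.log ‖(cmp i ((Z * Y)ᴴ * (Z * Y))).det‖ ≤ Real.log ‖(cmp i (Yᴴ * Y)).det‖ +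
      (U * Sm i * Uᴴ * (Z * Z - 1)).trace.re := by
  have h1 := qr_det hU i hT (Z * Z)
  have h2 := qr_one hUu hU i hT
  have e1 : (Z * Y)ᴴ * (Z * Y) = Yᴴ * (Z * Z) * Y := by
    simp only [conjTranspose_mul, hZ, mul_assoc]
  have h3 := cmp_det_ne (Y := Z * Y) (by rw [det_mul]; exact mul_ne_zero hZd hY) i
  have h4 := cmp_det_ne hY i
  rw [e1] at h3 ⊢
  set p := ‖(cmp i T).det‖
  set q := ‖(cmp i (Yᴴ * Y)).det‖
  set r := ‖(cmp i (Yᴴ * (Z * Z) * Y)).det‖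
  have hp : p ^ 2 ≠ 0 := fun h => by rw [h, zero_mul] at h2; exact one_ne_zero h2
  have h5 : Real.log ‖(cmp i (Uᴴ * (Z * Z) * U)).det‖ = Real.log r - Real.log q := by
    have l2 := congrArg Real.log h2
    rw [Real.log_one, Real.log_mul hp h4] at l2
    rw [h1, Real.log_mul hp h3]
    linarith
  have hpsd : (Uᴴ * (Z * Z) * U).PosSemidef := by
    have := posSemidef_conjTranspose_mul_self (Z * U)
    have e : (Z * U)ᴴ * (Z * U) = Uᴴ * (Z * Z) * U := by
      simp only [conjTranspose_mul, hZ, mul_assoc]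
    rwa [e] at this
  have h6 := det_le_exp (cmp_psd i hpsd)
  have h7 : 0 < ‖(cmp i (Uᴴ * (Z * Z) * U)).det‖ := by
    rw [h1]
    have : p ^ 2 * r ≠ 0 := mul_ne_zero hp h3
    exact lt_of_le_of_ne (mul_nonneg (sq_nonneg _) (norm_nonneg _)) this.symm
  have h8 := Real.log_le_log h7 h6
  rw [Real.log_exp, h5] at h8
  have h9 : (cmp i (Uᴴ * (Z * Z) * U)).trace =
      (U * Sm i * Uᴴ * (Z * Z - 1)).trace + (n : ℂ) := by
    have t1 : (Sm i * (Uᴴ * (Z * Z) * U) * Sm i).trace = (U * Sm i * Uᴴ * (Z * Z)).trace := by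
      rw [trace_mul_comm, ← mul_assoc, Sm_idem]
      calc (Sm i * (Uᴴ * (Z * Z) * U)).trace = (Sm i * Uᴴ * (Z * Z) * U).trace := by
            simp only [mul_assoc]
        _ = _ := by rw [trace_mul_comm]; simp only [mul_assoc]
    have t2 : (U * Sm i * Uᴴ).trace = (Sm i).trace := by
      rw [trace_mul_cycle, unit2 hUu, one_mul]
    rw [cmp, trace_add, t1, mul_sub, trace_sub, trace_sub, mul_one, t2, trace_one]
    simp
    ring
  rw [h9, Complex.add_re, Complex.natCast_re] at h8
  linarith

/-- The moment map. -/
noncomputable def Am {n : ℕ} (w : Fin 3 → Fin n → ℝ) (c : ℝ)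
    (U : Fin 3 → Matrix (Fin n) (Fin n) ℂ) : Matrix (Fin n) (Fin n) ℂ :=
  ∑ a, ∑ i, (w a i : ℂ) • (U a * Sm i * (U a)ᴴ) - (c : ℂ) • 1

lemma Am_herm {n : ℕ} (w : Fin 3 → Fin n → ℝ) (c : ℝ)
    (U : Fin 3 → Matrix (Fin n) (Fin n) ℂ) : (Am w c U)ᴴ = Am w c U := by
  unfold Am
  simp only [conjTranspose_sub, conjTranspose_sum, conjTranspose_smul, conjTranspose_mul,
    conjTranspose_conjTranspose, Sm_herm, conjTranspose_one, Complex.star_def, Complex.conj_ofReal,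
    mul_assoc]

lemma trace_proj_le {n : ℕ} {P A : Matrix (Fin n) (Fin n) ℂ} (h1 : Pᴴ = P) (h2 : P * P = P)
    (hA : Aᴴ = A) : (P * (A * A)).trace.re ≤ (A * A).trace.re := by
  have := (proj_psd (proj_compl h1 h2).1 (proj_compl h1 h2).2).conjTranspose_mul_mul_same A
  have h3 := (Complex.le_def.1 this.trace_nonneg).1
  rw [hA, trace_mul_cycle, mul_sub, mul_one, trace_sub, Complex.sub_re, trace_mul_comm (A * A)] at h3
  simpa using h3

lemma psi_step {n : ℕ} {B : Fin 3 → Matrix (Fin n) (Fin n) ℂ} {w : Fin 3 → Fin n → ℝ}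
    {c : ℝ} (hB : ∀ a, (B a).det ≠ 0) (hw : ∀ a i, 0 ≤ w a i) (hc : 0 ≤ c)
    {g : Matrix (Fin n) (Fin n) ℂ} (hg : g.det ≠ 0) :
    ∃ U : Fin 3 → Matrix (Fin n) (Fin n) ℂ, (∀ a, U a ∈ unitaryGroup (Fin n) ℂ) ∧
      ∀ t : ℝ, t ^ 2 * (Am w c U * Am w c U).trace.re ≤ 1 / 4 →
      ∃ g' : Matrix (Fin n) (Fin n) ℂ, g'.det ≠ 0 ∧ psi B w c (g'ᴴ * g') ≤ psi B w c (gᴴ * g)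
        - 2 * t * (Am w c U * Am w c U).trace.re
        + t ^ 2 * ((∑ a, ∑ i, w a i) + 4 * c) * (Am w c U * Am w c U).trace.re := by
  have hY : ∀ a, (g * B a).det ≠ 0 := fun a => by
    rw [det_mul]; exact mul_ne_zero hg (hB a)
  choose U T hUu hU hT using fun a => exists_qr (hY a)
  refine ⟨U, hUu, fun t ht => ?_⟩
  set A := Am w c U with hA
  have hAh : Aᴴ = A := Am_herm w c U
  set F := (A * A).trace.re with hF
  set Z : Matrix (Fin n) (Fin n) ℂ := 1 - (t : ℂ) • A with hZ
  have hZh : Zᴴ = Z := by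
    rw [hZ, conjTranspose_sub, conjTranspose_smul, hAh]; simp
  have hZ1 : 1 - Z = (t : ℂ) • A := by rw [hZ]; abel
  have hZ2 : ((1 - Z) * (1 - Z)).trace.re = t ^ 2 * F := by
    rw [hZ1, smul_mul_smul_comm, trace_smul, smul_eq_mul, ← Complex.ofReal_mul,
      Complex.re_ofReal_mul, sq]
  obtain ⟨hZd, hlog⟩ := neg_log_det_le (Z := Z) hZh (by rw [hZ2]; exact ht)
  rw [hZ2, hZ1, trace_smul, smul_eq_mul, Complex.re_ofReal_mul] at hlog
  have hZZ : Z * Z - 1 = (t ^ 2 : ℂ) • (A * A) - (2 * t : ℂ) • A := by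
    rw [hZ, sub_mul, mul_sub, mul_sub, smul_mul_smul_comm, one_mul, mul_one, one_mul, sq,
      mul_smul, two_mul, add_smul]
    abel
  refine ⟨Z * g, by rw [det_mul]; exact mul_ne_zero hZd hg, ?_⟩
  have hterm : ∀ a i, Real.log ‖(cmp i ((B a)ᴴ * ((Z * g)ᴴ * (Z * g)) * B a)).det‖ ≤
      Real.log ‖(cmp i ((B a)ᴴ * (gᴴ * g) * B a)).det‖ + t ^ 2 * F
        - 2 * t * ((U a * Sm i * (U a)ᴴ) * A).trace.re := by
    intro a i
    have h1 := log_cmp_step (hY a) (hUu a) (hU a) i (hT a i) hZh hZd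
    have e1 : (Z * (g * B a))ᴴ * (Z * (g * B a)) = (B a)ᴴ * ((Z * g)ᴴ * (Z * g)) * B a := by
      simp only [conjTranspose_mul, mul_assoc]
    have e2 : (g * B a)ᴴ * (g * B a) = (B a)ᴴ * (gᴴ * g) * B a := by
      simp only [conjTranspose_mul, mul_assoc]
    rw [e1, e2] at h1
    have h2 := trace_proj_le (conj_proj (hUu a) i).1 (conj_proj (hUu a) i).2 hAh
    have h3 : (U a * Sm i * (U a)ᴴ * (Z * Z - 1)).trace.re =
        t ^ 2 * (U a * Sm i * (U a)ᴴ * (A * A)).trace.re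
          - 2 * t * (U a * Sm i * (U a)ᴴ * A).trace.re := by
      rw [hZZ, mul_sub, trace_sub, mul_smul_comm, mul_smul_comm, trace_smul, trace_smul,
        Complex.sub_re, smul_eq_mul, smul_eq_mul]
      have c1 : (t ^ 2 : ℂ) = ((t ^ 2 : ℝ) : ℂ) := by push_cast; rfl
      have c2 : (2 * t : ℂ) = ((2 * t : ℝ) : ℂ) := by push_cast; rfl
      rw [c1, c2, Complex.re_ofReal_mul, Complex.re_ofReal_mul]
    rw [h3] at h1
    have h4 := mul_le_mul_of_nonneg_left h2 (sq_nonneg t)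
    linarith
  have hsum : ∑ a, ∑ i, w a i * Real.log ‖(cmp i ((B a)ᴴ * ((Z * g)ᴴ * (Z * g)) * B a)).det‖ ≤
      ∑ a, ∑ i, w a i * (Real.log ‖(cmp i ((B a)ᴴ * (gᴴ * g) * B a)).det‖ + t ^ 2 * F
        - 2 * t * ((U a * Sm i * (U a)ᴴ) * A).trace.re) :=
    Finset.sum_le_sum fun a _ => Finset.sum_le_sum fun i _ =>
      mul_le_mul_of_nonneg_left (hterm a i) (hw a i)
  have hexp : ∑ a, ∑ i, w a i * (Real.log ‖(cmp i ((B a)ᴴ * (gᴴ * g) * B a)).det‖ + t ^ 2 * F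
        - 2 * t * ((U a * Sm i * (U a)ᴴ) * A).trace.re) =
      ∑ a, ∑ i, w a i * Real.log ‖(cmp i ((B a)ᴴ * (gᴴ * g) * B a)).det‖
        + t ^ 2 * F * (∑ a, ∑ i, w a i)
        - 2 * t * ∑ a, ∑ i, w a i * ((U a * Sm i * (U a)ᴴ) * A).trace.re := by
    simp only [Finset.mul_sum, ← Finset.sum_add_distrib, ← Finset.sum_sub_distrib]
    refine Finset.sum_congr rfl fun a _ => Finset.sum_congr rfl fun i _ => ?_
    ring
  have hmom : ∑ a, ∑ i, w a i * ((U a * Sm i * (U a)ᴴ) * A).trace.re = F + c * A.trace.re := by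
    have : A * A = (∑ a, ∑ i, (w a i : ℂ) • (U a * Sm i * (U a)ᴴ) - (c : ℂ) • 1) * A := by
      rw [hA]; rfl
    rw [hF, this, sub_mul, smul_mul_assoc, one_mul, trace_sub, trace_smul, Complex.sub_re,
      smul_eq_mul, Complex.re_ofReal_mul]
    simp only [Finset.sum_mul, trace_sum, Complex.re_sum, smul_mul_assoc, trace_smul, smul_eq_mul,
      Complex.re_ofReal_mul]
    ring
  have hdet : Real.log ‖((Z * g)ᴴ * (Z * g)).det‖ =
      2 * Real.log ‖Z.det‖ + Real.log ‖(gᴴ * g).det‖ := by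
    have z0 := norm_ne_zero_iff.2 hZd
    have g0 := norm_ne_zero_iff.2 hg
    simp only [det_mul, det_conjTranspose, norm_mul, norm_star]
    rw [Real.log_mul (mul_ne_zero z0 g0) (mul_ne_zero z0 g0), Real.log_mul z0 g0,
      Real.log_mul g0 g0]
    ring
  rw [hexp, hmom] at hsum
  have hcl := mul_le_mul_of_nonneg_left hlog hc
  unfold psi
  rw [hdet]
  nlinarith

lemma psi_bdd' {n : ℕ} {B : Fin 3 → Matrix (Fin n) (Fin n) ℂ} {w : Fin 3 → Fin n → ℝ}
    {c : ℝ} (hB : ∀ a, (B a).det ≠ 0) (hw : ∀ a i, 0 ≤ w a i) (hSS : SS B w c)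
    (htr : ∑ a, ∑ i : Fin n, w a i * ((i : ℝ) + 1) = c * n) :
    ∃ C : ℝ, ∀ g : Matrix (Fin n) (Fin n) ℂ, g.det ≠ 0 → -C ≤ psi B w c (gᴴ * g) := by
  obtain ⟨C, hC⟩ := psi_bdd hB hw hSS htr
  refine ⟨C, fun g hg => ?_⟩
  have hinj : Function.Injective g.mulVec := by
    apply mulVec_injective_of_isUnit
    rw [isUnit_iff_isUnit_det]
    exact isUnit_iff_ne_zero.2 hg
  have hpd : (gᴴ * g).PosDef := PosDef.conjTranspose_mul_self _ hinj
  obtain ⟨V, hV, hVe⟩ := spectral_desc hpd.1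
  have hpos : ∀ j, 0 < eigsDesc hpd.1 j := fun j => hpd.eigenvalues_pos _
  have h1 := hC Vᴴ (by
    rw [mem_unitaryGroup_iff, star_eq_conjTranspose, conjTranspose_conjTranspose]; exact unit2 hV)
    (fun j => Real.log (eigsDesc hpd.1 j))
    (fun i j hij => Real.log_le_log (hpos j) (eigsDesc_antitone hpd.1 hij))
  simp only [Real.exp_log (hpos _), conjTranspose_conjTranspose] at h1
  rwa [← hVe] at h1

lemma F_nonneg {n : ℕ} {A : Matrix (Fin n) (Fin n) ℂ} (hA : Aᴴ = A) : 0 ≤ (A * A).trace.re := by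
  have := (posSemidef_conjTranspose_mul_self A).trace_nonneg
  rw [hA] at this
  exact (Complex.le_def.1 this).1

lemma continuous_F {n : ℕ} (w : Fin 3 → Fin n → ℝ) (c : ℝ) :
    Continuous fun U : Fin 3 → Matrix (Fin n) (Fin n) ℂ => (Am w c U * Am w c U).trace.re := by
  have hAc : Continuous fun U : Fin 3 → Matrix (Fin n) (Fin n) ℂ => Am w c U := by
    unfold Am
    refine Continuous.sub ?_ continuous_const
    refine continuous_finsetSum _ fun a _ => continuous_finsetSum _ fun i _ => ?_
    have h1 : Continuous fun U : Fin 3 → Matrix (Fin n) (Fin n) ℂ => U a := continuous_apply a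
    have h2 : Continuous fun U : Fin 3 → Matrix (Fin n) (Fin n) ℂ => U a * Sm i * (U a)ᴴ :=
      (h1.matrix_mul continuous_const).matrix_mul h1.matrix_conjTranspose
    exact h2.const_smul (w a i : ℂ)
  exact Complex.continuous_re.comp (hAc.matrix_mul hAc).matrix_trace

lemma exists_step_size {W c M : ℝ} (hW : 0 ≤ W) (hc : 0 ≤ c) (hM : 0 ≤ M) :
    ∃ t : ℝ, 0 < t ∧ t * (W + 4 * c) ≤ 1 ∧ t ^ 2 * M ≤ 1 / 4 := by
  have hden : 0 < 2 * (1 + M) + W + 4 * c := by positivity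
  obtain ⟨t, ht⟩ : ∃ t : ℝ, t = 1 / (2 * (1 + M) + W + 4 * c) := ⟨_, rfl⟩
  have htpos : 0 < t := by rw [ht]; positivity
  have ht1 : t * (2 * (1 + M) + W + 4 * c) = 1 := by rw [ht]; field_simp
  have a1 := mul_nonneg htpos.le hM
  have a2 := mul_nonneg htpos.le hW
  have a3 := mul_nonneg htpos.le hc
  refine ⟨t, htpos, by nlinarith, ?_⟩
  have q2 : t ≤ 1 / 2 := by nlinarith
  have q3 : t * M ≤ 1 / 2 := by nlinarith
  nlinarith

lemma feas_of_ss {n : ℕ} {B : Fin 3 → Matrix (Fin n) (Fin n) ℂ} {w : Fin 3 → Fin n → ℝ}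
    {c : ℝ} (hB : ∀ a, (B a).det ≠ 0) (hw : ∀ a i, 0 ≤ w a i) (hc : 0 ≤ c) (hSS : SS B w c)
    (htr : ∑ a, ∑ i : Fin n, w a i * ((i : ℝ) + 1) = c * n) : Feas w c := by
  obtain ⟨C, hC⟩ := psi_bdd' hB hw hSS htr
  have hK : IsCompact (Set.pi Set.univ
      (fun _ : Fin 3 => {U : Matrix (Fin n) (Fin n) ℂ | U ∈ unitaryGroup (Fin n) ℂ})) :=
    isCompact_univ_pi fun _ => isCompact_unitary n
  set K := Set.pi Set.univ
      (fun _ : Fin 3 => {U : Matrix (Fin n) (Fin n) ℂ | U ∈ unitaryGroup (Fin n) ℂ}) with hKd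
  have hne : K.Nonempty := ⟨fun _ => 1, fun _ _ => one_mem (unitaryGroup (Fin n) ℂ)⟩
  obtain ⟨F, hFdef⟩ : ∃ F : (Fin 3 → Matrix (Fin n) (Fin n) ℂ) → ℝ,
    ∀ U, F U = (Am w c U * Am w c U).trace.re := ⟨_, fun _ => rfl⟩
  have hFc : Continuous F := by
    rw [funext hFdef]
    exact continuous_F w c
  obtain ⟨U0, hU0, hmin⟩ := hK.exists_isMinOn hne hFc.continuousOn
  obtain ⟨U1, hU1, hmax⟩ := hK.exists_isMaxOn hne hFc.continuousOn
  have hF0 : ∀ U, 0 ≤ F U := fun U => by rw [hFdef]; exact F_nonneg (Am_herm w c U)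
  rcases (hF0 U0).eq_or_lt with h0 | hpos
  · refine ⟨U0, fun a => hU0 a (Set.mem_univ _), ?_⟩
    have h1 := (posSemidef_conjTranspose_mul_self (Am w c U0)).trace_nonneg
    have h2 : ((Am w c U0)ᴴ * Am w c U0).trace = 0 := by
      rw [Am_herm] at h1 ⊢
      apply Complex.ext
      · exact ((hFdef U0).symm.trans h0.symm)
      · exact (Complex.le_def.1 h1).2.symm
    rw [trace_conjTranspose_mul_self_eq_zero_iff] at h2
    exact sub_eq_zero.1 h2
  · exfalso
    obtain ⟨W, hW⟩ : ∃ W : ℝ, W = ∑ a, ∑ i, w a i := ⟨_, rfl⟩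
    have hW0 : 0 ≤ W := by
      rw [hW]
      exact Finset.sum_nonneg fun a _ => Finset.sum_nonneg fun i _ => hw a i
    obtain ⟨t, htpos, htW, htF⟩ := exists_step_size hW0 hc (hF0 U1)
    have hstep : ∀ g : Matrix (Fin n) (Fin n) ℂ, g.det ≠ 0 →
        ∃ g' : Matrix (Fin n) (Fin n) ℂ, g'.det ≠ 0 ∧
          psi B w c (g'ᴴ * g') ≤ psi B w c (gᴴ * g) - t * F U0 := by
      intro g hg
      obtain ⟨U, hU, h⟩ := psi_step hB hw hc hg
      rw [← hFdef, ← hW] at h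
      have hUK : U ∈ K := fun a _ => hU a
      have hUmin : F U0 ≤ F U := hmin hUK
      have hUmax : F U ≤ F U1 := hmax hUK
      obtain ⟨g', hg', hle⟩ := h t (by
        refine le_trans ?_ htF
        exact mul_le_mul_of_nonneg_left hUmax (sq_nonneg t))
      refine ⟨g', hg', hle.trans ?_⟩
      have p1 : t * F U0 ≤ t * F U := mul_le_mul_of_nonneg_left hUmin htpos.le
      have p2 : t ^ 2 * (W + 4 * c) * F U ≤ t * F U := by
        have := mul_le_mul_of_nonneg_right htW (mul_nonneg htpos.le (hF0 U))
        nlinarith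
      linarith
    have hiter : ∀ m : ℕ, ∃ g : Matrix (Fin n) (Fin n) ℂ, g.det ≠ 0 ∧
        psi B w c (gᴴ * g) ≤ psi B w c (1ᴴ * 1) - m * (t * F U0) := by
      intro m
      induction m with
      | zero => exact ⟨1, by simp, by simp⟩
      | succ m ih =>
        obtain ⟨g, hg, h⟩ := ih
        obtain ⟨g', hg', h'⟩ := hstep g hg
        refine ⟨g', hg', ?_⟩
        push_cast
        linarith
    have hε : 0 < t * F U0 := mul_pos htpos hpos
    obtain ⟨m, hm⟩ := exists_nat_gt ((psi B w c (1ᴴ * 1) + C) / (t * F U0))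
    rw [div_lt_iff₀ hε] at hm
    obtain ⟨g, hg, h⟩ := hiter m
    have := hC g hg
    linarith

lemma feas_convex {n : ℕ} (hn : 0 < n) {w w' : Fin 3 → Fin n → ℝ} {c c' s t : ℝ}
    (hw : ∀ a i, 0 ≤ w a i) (hw' : ∀ a i, 0 ≤ w' a i) (hc : 0 ≤ c) (hc' : 0 ≤ c')
    (hs : 0 ≤ s) (ht : 0 ≤ t) (h : Feas w c) (h' : Feas w' c') :
    Feas (fun a i => s * w a i + t * w' a i) (s * c + t * c') := by
  obtain ⟨B, hB, hgen⟩ := exists_generic_flags n hn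
  have h1 := hgen w c hw hc h
  have h2 := hgen w' c' hw' hc' h'
  refine feas_of_ss hB (fun a i => add_nonneg (mul_nonneg hs (hw a i)) (mul_nonneg ht (hw' a i)))
    (add_nonneg (mul_nonneg hs hc) (mul_nonneg ht hc')) ?_ ?_
  · intro N
    have k1 := mul_le_mul_of_nonneg_left (h1 N) hs
    have k2 := mul_le_mul_of_nonneg_left (h2 N) ht
    have : ∑ a, ∑ i, (s * w a i + t * w' a i) * ((N * B a * Sm i).rank : ℝ) =
        s * ∑ a, ∑ i, w a i * ((N * B a * Sm i).rank : ℝ) +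
        t * ∑ a, ∑ i, w' a i * ((N * B a * Sm i).rank : ℝ) := by
      simp only [Finset.mul_sum, ← Finset.sum_add_distrib]
      refine Finset.sum_congr rfl fun a _ => Finset.sum_congr rfl fun i _ => ?_
      ring
    rw [this]
    linarith
  · have k1 := feas_trace h
    have k2 := feas_trace h'
    have : ∑ a, ∑ i : Fin n, (s * w a i + t * w' a i) * ((i : ℝ) + 1) =
        s * ∑ a, ∑ i : Fin n, w a i * ((i : ℝ) + 1) +
        t * ∑ a, ∑ i : Fin n, w' a i * ((i : ℝ) + 1) := by
      simp only [Finset.mul_sum, ← Finset.sum_add_distrib]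
      refine Finset.sum_congr rfl fun a _ => Finset.sum_congr rfl fun i _ => ?_
      ring
    rw [this, k1, k2]
    ring

lemma sort_antitone {n : ℕ} {f : Fin n → ℝ} (hf : Antitone f) :
    (Multiset.map f Finset.univ.val).sort (· ≥ ·) = List.ofFn f := by
  rw [Fin.univ_val_map, Multiset.coe_sort]
  apply List.mergeSort_of_pairwise
  simp_rw [decide_eq_true_eq, ← List.sortedGE_iff_pairwise]
  exact hf.sortedGE_ofFn

lemma eigs_unique {n : ℕ} {A U : Matrix (Fin n) (Fin n) ℂ} (hA : A.IsHermitian)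
    (hU : U ∈ unitaryGroup (Fin n) ℂ) {l : Fin n → ℝ} (hl : Antitone l)
    (h : A = U * diagonal (fun j => (l j : ℂ)) * Uᴴ) : eigsDesc hA = l := by
  have key : ∀ (V : Matrix (Fin n) (Fin n) ℂ) (x : Fin n → ℝ), V ∈ unitaryGroup (Fin n) ℂ →
      A = V * diagonal (fun j => (x j : ℂ)) * Vᴴ →
      A.charpoly.roots.map Complex.re = Multiset.map x Finset.univ.val := by
    intro V x hV hx
    have h1 : A.charpoly = ∏ j, (Polynomial.X - Polynomial.C (x j : ℂ)) := by
      rw [hx, charpoly_mul_comm, ← mul_assoc, unit2 hV, one_mul, charpoly_diagonal]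
    rw [h1, Polynomial.roots_prod]
    · simp [Function.comp_def]
    · simp [Finset.prod_ne_zero_iff, Polynomial.X_sub_C_ne_zero]
  obtain ⟨V, hV, hVe⟩ := spectral_desc hA
  have h1 := key V _ hV hVe
  have h2 := key U _ hU h
  have h3 := sort_antitone (eigsDesc_antitone hA)
  have h4 := sort_antitone hl
  rw [← h1, h2, h4] at h3
  exact (List.ofFn_injective h3).symm

/-- Partial sums. -/
noncomputable def ps {n : ℕ} : (Fin n → ℝ) →ₗ[ℝ] (Fin n → ℝ) where
  toFun x i := ∑ j ∈ Finset.Iic i, x j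
  map_add' x y := by ext i; simp [Finset.sum_add_distrib]
  map_smul' c x := by ext i; simp [Finset.mul_sum]

lemma ps_inj {n : ℕ} : Function.Injective (ps (n := n)) := by
  intro x y h
  have h1 : ∀ i, ∑ j ∈ Finset.Iic i, x j = ∑ j ∈ Finset.Iic i, y j := fun i => congrFun h i
  ext i
  induction i using WellFoundedLT.induction with
  | ind i ih =>
    have h2 := h1 i
    rw [← Finset.Iio_insert i, Finset.sum_insert (by simp), Finset.sum_insert (by simp),
      Finset.sum_congr rfl (fun j hj => ih j (Finset.mem_Iio.1 hj))] at h2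
    linarith

lemma lMap_eq {n : ℕ} {A : Matrix (Fin n) (Fin n) ℂ} (hA : A.IsHermitian) :
    lMap hA = ps (eigsDesc hA) := rfl

/-- Conjugated real diagonal matrix. -/
noncomputable def cd {n : ℕ} (U : Matrix (Fin n) (Fin n) ℂ) (x : Fin n → ℝ) :
    Matrix (Fin n) (Fin n) ℂ := U * diagonal (fun j => (x j : ℂ)) * Uᴴ

lemma cd_herm {n : ℕ} (U : Matrix (Fin n) (Fin n) ℂ) (x : Fin n → ℝ) : (cd U x).IsHermitian := by
  have : (diagonal (fun j => (x j : ℂ)))ᴴ = diagonal (fun j => (x j : ℂ)) := by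
    rw [diagonal_conjTranspose]; congr 1; ext j; simp
  simp [IsHermitian, cd, this, mul_assoc]

lemma diag_wt {n : ℕ} (x : Fin n → ℝ) :
    diagonal (fun j => (x j : ℂ)) = ∑ i, (wt x i : ℂ) • Sm i := by
  ext j k
  rw [Matrix.sum_apply]
  simp only [Matrix.smul_apply, Sm, diagonal_apply, smul_eq_mul]
  by_cases hjk : j = k
  · subst hjk
    simp only [if_true]
    conv_lhs => rw [← sum_wt x j]
    push_cast
    refine Finset.sum_congr rfl fun i _ => ?_
    split_ifs <;> simp_all
  · simp [hjk]

lemma cd_wt {n : ℕ} (U : Matrix (Fin n) (Fin n) ℂ) (x : Fin n → ℝ) :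
    cd U x = ∑ i, (wt x i : ℂ) • (U * Sm i * Uᴴ) := by
  rw [cd, diag_wt, Finset.mul_sum, Finset.sum_mul]
  refine Finset.sum_congr rfl fun i _ => ?_
  rw [mul_smul_comm, smul_mul_assoc]

lemma feas_iff {n : ℕ} (l : Fin 3 → Fin n → ℝ) (c : ℝ) :
    Feas (fun a => wt (l a)) c ↔ ∃ U : Fin 3 → Matrix (Fin n) (Fin n) ℂ,
      (∀ a, U a ∈ unitaryGroup (Fin n) ℂ) ∧ ∑ a, cd (U a) (l a) = (c : ℂ) • 1 := by
  simp only [Feas, cd_wt]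

lemma cd_shift {n : ℕ} {U : Matrix (Fin n) (Fin n) ℂ} (hU : U ∈ unitaryGroup (Fin n) ℂ)
    (x : Fin n → ℝ) (p : ℝ) : cd U (fun j => x j + p) = cd U x + (p : ℂ) • 1 := by
  have : diagonal (fun j => ((x j + p : ℝ) : ℂ)) =
      diagonal (fun j => (x j : ℂ)) + (p : ℂ) • (1 : Matrix (Fin n) (Fin n) ℂ) := by
    rw [smul_one_eq_diagonal, diagonal_add]
    simp
  rw [cd, this, mul_add, add_mul, mul_smul_comm, smul_mul_assoc, mul_one, unit1 hU]
  rfl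

lemma cd_rev {n : ℕ} {U : Matrix (Fin n) (Fin n) ℂ} (hU : U ∈ unitaryGroup (Fin n) ℂ)
    (x : Fin n → ℝ) (p : ℝ) :
    cd U (fun j => p - x j.rev) = (p : ℂ) • 1 - cd (U.submatrix id Fin.revPerm) x := by
  have h1 : diagonal (fun j : Fin n => ((p - x j.rev : ℝ) : ℂ)) =
      (p : ℂ) • (1 : Matrix (Fin n) (Fin n) ℂ) - diagonal (fun j => (x j.rev : ℂ)) := by
    rw [smul_one_eq_diagonal, diagonal_sub]
    simp
  have h2 : diagonal (fun j => (x j : ℂ)) =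
      (diagonal (fun j => (x j.rev : ℂ))).submatrix Fin.revPerm Fin.revPerm := by
    rw [submatrix_diagonal_equiv]
    congr 1
    ext j
    simp
  rw [cd, cd, h1, h2, conjTranspose_submatrix, submatrix_mul_equiv, submatrix_mul_equiv,
    submatrix_id_id, mul_sub, sub_mul, mul_smul_comm, smul_mul_assoc, mul_one, unit1 hU]

lemma unitary_rev {n : ℕ} {U : Matrix (Fin n) (Fin n) ℂ} (hU : U ∈ unitaryGroup (Fin n) ℂ) :
    U.submatrix id Fin.revPerm ∈ unitaryGroup (Fin n) ℂ := by
  rw [mem_unitaryGroup_iff, star_eq_conjTranspose, conjTranspose_submatrix, submatrix_mul_equiv,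
    unit1 hU, submatrix_id_id]

/-- Eigenvalue version of the Horn polytope. -/
def Q {n : ℕ} (α β : Fin n → ℝ) : Set (Fin n → ℝ) :=
  {γ | Antitone γ ∧ ∃ U V W : Matrix (Fin n) (Fin n) ℂ, U ∈ unitaryGroup (Fin n) ℂ ∧
    V ∈ unitaryGroup (Fin n) ℂ ∧ W ∈ unitaryGroup (Fin n) ℂ ∧ cd U α + cd V β = cd W γ}

/-- The nonnegative spectra attached to a point of the polytope. -/
def trip {n : ℕ} (α β γ : Fin n → ℝ) (p q τ : ℝ) : Fin 3 → Fin n → ℝ :=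
  ![fun j => α j + p, fun j => β j + q, fun j => τ - γ j.rev]

lemma trip_feas_iff {n : ℕ} (α β γ : Fin n → ℝ) (p q τ : ℝ) :
    Feas (fun a => wt (trip α β γ p q τ a)) (p + q + τ) ↔
      ∃ U V W : Matrix (Fin n) (Fin n) ℂ, U ∈ unitaryGroup (Fin n) ℂ ∧
        V ∈ unitaryGroup (Fin n) ℂ ∧ W ∈ unitaryGroup (Fin n) ℂ ∧ cd U α + cd V β = cd W γ := by
  rw [feas_iff]
  constructor
  · rintro ⟨U, hU, h⟩
    refine ⟨U 0, U 1, (U 2).submatrix id Fin.revPerm, hU 0, hU 1, unitary_rev (hU 2), ?_⟩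
    rw [Fin.sum_univ_three] at h
    simp only [trip, cons_val_zero, cons_val_one, cons_val] at h
    rw [cd_shift (hU 0), cd_shift (hU 1), cd_rev (hU 2)] at h
    push_cast at h
    rw [add_smul, add_smul] at h
    rw [← sub_eq_zero] at h ⊢
    rw [← h]
    abel
  · rintro ⟨U, V, W, hU, hV, hW, h⟩
    refine ⟨![U, V, W.submatrix id Fin.revPerm], ?_, ?_⟩
    · intro a
      fin_cases a
      · exact hU
      · exact hV
      · exact unitary_rev hW
    · rw [Fin.sum_univ_three]
      simp only [trip, cons_val_zero, cons_val_one, cons_val]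
      rw [cd_shift hU, cd_shift hV, cd_rev (unitary_rev hW)]
      have : (W.submatrix id Fin.revPerm).submatrix id Fin.revPerm = W := by
        ext i j; simp
      rw [this, ← h]
      push_cast
      rw [add_smul, add_smul]
      abel

lemma abs_le_sum {n : ℕ} (x : Fin n → ℝ) (j : Fin n) : |x j| ≤ ∑ k, |x k| :=
  Finset.single_le_sum (f := fun k => |x k|) (fun k _ => abs_nonneg _) (Finset.mem_univ j)

lemma Q_convex {n : ℕ} (hn : 0 < n) {α β : Fin n → ℝ} (hα : Antitone α) (hβ : Antitone β) :
    Convex ℝ (Q α β) := by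
  rintro γ ⟨hγ, h⟩ γ' ⟨hγ', h'⟩ s t hs ht hst
  refine ⟨?_, ?_⟩
  · intro i j hij
    simp only [Pi.add_apply, Pi.smul_apply, smul_eq_mul]
    exact add_le_add (mul_le_mul_of_nonneg_left (hγ hij) hs)
      (mul_le_mul_of_nonneg_left (hγ' hij) ht)
  obtain ⟨p, hp⟩ : ∃ p : ℝ, p = ∑ k, |α k| := ⟨_, rfl⟩
  obtain ⟨q, hq⟩ : ∃ q : ℝ, q = ∑ k, |β k| := ⟨_, rfl⟩
  obtain ⟨τ, hτ⟩ : ∃ τ : ℝ, τ = ∑ k, |γ k| + ∑ k, |γ' k| := ⟨_, rfl⟩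
  have np : 0 ≤ p := by rw [hp]; exact Finset.sum_nonneg fun _ _ => abs_nonneg _
  have nq : 0 ≤ q := by rw [hq]; exact Finset.sum_nonneg fun _ _ => abs_nonneg _
  have ng : 0 ≤ ∑ k, |γ k| := Finset.sum_nonneg fun _ _ => abs_nonneg _
  have ng' : 0 ≤ ∑ k, |γ' k| := Finset.sum_nonneg fun _ _ => abs_nonneg _
  have nτ : 0 ≤ τ := by rw [hτ]; exact add_nonneg ng ng'
  have hgen : ∀ δ : Fin n → ℝ, Antitone δ → (∀ j, δ j ≤ τ) →
      ∀ a i, 0 ≤ wt (trip α β δ p q τ a) i := by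
    intro δ hδ hδτ a i
    fin_cases a
    · refine wt_nonneg (h := fun j => α j + p) (fun x y hxy => by
        have := hα hxy; simp only; linarith) (fun k => ?_) i
      have := abs_le_sum α k
      have := neg_abs_le (α k)
      linarith
    · refine wt_nonneg (h := fun j => β j + q) (fun x y hxy => by
        have := hβ hxy; simp only; linarith) (fun k => ?_) i
      have := abs_le_sum β k
      have := neg_abs_le (β k)
      linarith
    · refine wt_nonneg (h := fun j => τ - δ j.rev) (fun x y hxy => by
        have := hδ (Fin.rev_le_rev.2 hxy); simp only; linarith) (fun k => ?_) i
      have := hδτ k.rev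
      linarith
  have b1 : ∀ j, γ j ≤ τ := fun j => by
    have := abs_le_sum γ j
    have := le_abs_self (γ j)
    linarith
  have b2 : ∀ j, γ' j ≤ τ := fun j => by
    have := abs_le_sum γ' j
    have := le_abs_self (γ' j)
    linarith
  have f1 := (trip_feas_iff α β γ p q τ).2 h
  have f2 := (trip_feas_iff α β γ' p q τ).2 h'
  have hc : 0 ≤ p + q + τ := by positivity
  have f3 := feas_convex hn (hgen γ hγ b1) (hgen γ' hγ' b2) hc hc hs ht f1 f2
  refine (trip_feas_iff α β (s • γ + t • γ') p q τ).1 ?_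
  have e1 : s * (p + q + τ) + t * (p + q + τ) = p + q + τ := by
    rw [← add_mul, hst, one_mul]
  have e2 : (fun a i => s * wt (trip α β γ p q τ a) i + t * wt (trip α β γ' p q τ a) i) =
      fun a => wt (trip α β (s • γ + t • γ') p q τ a) := by
    funext a i
    rw [← wt_comb]
    congr 1
    have ht' : t = 1 - s := by linarith
    subst ht'
    funext j
    fin_cases a
    · simp [trip]; ring
    · simp [trip]; ring
    · simp [trip]; ring
  rw [e1, e2] at f3
  exact f3

lemma continuous_cd {n : ℕ} (x : Fin n → ℝ) :
    Continuous fun U : Matrix (Fin n) (Fin n) ℂ => cd U x :=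
  (continuous_id.matrix_mul continuous_const).matrix_mul continuous_id.matrix_conjTranspose

lemma Q_compact {n : ℕ} (α β : Fin n → ℝ) : IsCompact (Q α β) := by
  let X := Matrix (Fin n) (Fin n) ℂ
  let f : X × X × X → X := fun z => z.2.2ᴴ * (cd z.1 α + cd z.2.1 β) * z.2.2
  have hf : Continuous f := by
    have h3 : Continuous fun z : X × X × X => z.2.2 := continuous_snd.snd
    have h1 : Continuous fun z : X × X × X => cd z.1 α := (continuous_cd α).comp continuous_fst
    have h2 : Continuous fun z : X × X × X => cd z.2.1 β :=
      (continuous_cd β).comp continuous_snd.fst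
    exact (h3.matrix_conjTranspose.matrix_mul (h1.add h2)).matrix_mul h3
  let d : X → Fin n → ℝ := fun M j => (M j j).re
  have hd : Continuous d := by
    refine continuous_pi fun j => ?_
    exact Complex.continuous_re.comp (continuous_id.matrix_elem j j)
  have hcl : IsClosed {M : X | M = diagonal (fun j => (d M j : ℂ)) ∧ Antitone (d M)} := by
    refine IsClosed.inter (isClosed_eq continuous_id ?_) ?_
    · refine Continuous.matrix_diagonal ?_
      exact continuous_pi fun j => Complex.continuous_ofReal.comp ((continuous_apply j).comp hd)
    · have : {M : X | Antitone (d M)} = ⋂ i, ⋂ j, ⋂ _ : i ≤ j, {M : X | d M j ≤ d M i} := by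
        ext M
        simp [Antitone]
      change IsClosed {M : X | Antitone (d M)}
      rw [this]
      refine isClosed_iInter fun i => isClosed_iInter fun j => isClosed_iInter fun _ => ?_
      exact isClosed_le ((continuous_apply j).comp hd) ((continuous_apply i).comp hd)
  have hK := ((isCompact_unitary n).prod ((isCompact_unitary n).prod
    (isCompact_unitary n))).inter_right (hcl.preimage hf)
  have hI := hK.image (hd.comp hf)
  convert hI using 1
  ext γ
  constructor
  · rintro ⟨hγ, U, V, W, hU, hV, hW, h⟩
    have hfz : f (U, V, W) = diagonal (fun j => (γ j : ℂ)) := by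
      simp only [f]
      rw [h, cd]
      calc Wᴴ * (W * diagonal (fun j => (γ j : ℂ)) * Wᴴ) * W
          = (Wᴴ * W) * diagonal (fun j => (γ j : ℂ)) * (Wᴴ * W) := by simp only [mul_assoc]
        _ = _ := by rw [unit2 hW, one_mul, mul_one]
    have hdz : d (f (U, V, W)) = γ := by
      rw [hfz]; ext j; simp [d]
    refine ⟨(U, V, W), ⟨⟨hU, hV, hW⟩, ?_, ?_⟩, hdz⟩
    · rw [hdz]; exact hfz
    · rw [hdz]; exact hγ
  · rintro ⟨⟨U, V, W⟩, ⟨⟨hU, hV, hW⟩, h1, h2⟩, rfl⟩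
    refine ⟨h2, U, V, W, hU, hV, hW, ?_⟩
    change cd U α + cd V β = W * diagonal (fun j => ((d (f (U, V, W)) j : ℝ) : ℂ)) * Wᴴ
    rw [← h1]
    simp only [f]
    have hW' : W * Wᴴ = 1 := unit1 hW
    calc cd U α + cd V β = (W * Wᴴ) * (cd U α + cd V β) * (W * Wᴴ) := by
          rw [hW', one_mul, mul_one]
      _ = _ := by simp only [mul_assoc]

lemma horn_eq {n : ℕ} {α β : Fin n → ℝ} (hα : Antitone α) (hβ : Antitone β) :
    {t : Fin n → ℝ | ∃ (K₁ K₂ : Matrix (Fin n) (Fin n) ℂ)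
        (h₁ : K₁.IsHermitian) (h₂ : K₂.IsHermitian),
      lMap h₁ = ps α ∧ lMap h₂ = ps β ∧ lMap (h₁.add h₂) = t} = ps '' Q α β := by
  ext t
  constructor
  · rintro ⟨K₁, K₂, h₁, h₂, e1, e2, e3⟩
    rw [lMap_eq] at e1 e2 e3
    have e1' := ps_inj e1
    have e2' := ps_inj e2
    obtain ⟨U, hU, hUe⟩ := spectral_desc h₁
    obtain ⟨V, hV, hVe⟩ := spectral_desc h₂
    obtain ⟨W, hW, hWe⟩ := spectral_desc (h₁.add h₂)
    refine ⟨eigsDesc (h₁.add h₂), ⟨eigsDesc_antitone _, U, V, W, hU, hV, hW, ?_⟩, e3⟩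
    rw [e1'] at hUe
    rw [e2'] at hVe
    rw [cd, cd, cd, ← hWe, ← hUe, ← hVe]
  · rintro ⟨γ, ⟨hγ, U, V, W, hU, hV, hW, h⟩, rfl⟩
    refine ⟨cd U α, cd V β, cd_herm _ _, cd_herm _ _, ?_, ?_, ?_⟩
    · exact congrArg ps (eigs_unique _ hU hα rfl)
    · exact congrArg ps (eigs_unique _ hV hβ rfl)
    · rw [lMap_eq, eigs_unique _ hW hγ h]

end HornProof

/-- The Horn polytope `Π_{r,s} = {l(K₁ + K₂) : l(K₁) = r, l(K₂) = s}` is a nonempty,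
compact, convex subset of `ℝⁿ`, provided `r` and `s` are spectral data of Hermitian
matrices. -/
theorem horn_polytope_nonempty_compact_convex (n : ℕ) (hn : 0 < n)
    (r s : Fin n → ℝ)
    (hr : ∃ (K : Matrix (Fin n) (Fin n) ℂ) (hK : K.IsHermitian), lMap hK = r)
    (hs : ∃ (K' : Matrix (Fin n) (Fin n) ℂ) (hK' : K'.IsHermitian), lMap hK' = s) :
    ({t : Fin n → ℝ | ∃ (K₁ K₂ : Matrix (Fin n) (Fin n) ℂ)
        (h₁ : K₁.IsHermitian) (h₂ : K₂.IsHermitian),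
      lMap h₁ = r ∧ lMap h₂ = s ∧ lMap (h₁.add h₂) = t}).Nonempty ∧
    IsCompact {t : Fin n → ℝ | ∃ (K₁ K₂ : Matrix (Fin n) (Fin n) ℂ)
        (h₁ : K₁.IsHermitian) (h₂ : K₂.IsHermitian),
      lMap h₁ = r ∧ lMap h₂ = s ∧ lMap (h₁.add h₂) = t} ∧
    Convex ℝ {t : Fin n → ℝ | ∃ (K₁ K₂ : Matrix (Fin n) (Fin n) ℂ)
        (h₁ : K₁.IsHermitian) (h₂ : K₂.IsHermitian),
      lMap h₁ = r ∧ lMap h₂ = s ∧ lMap (h₁.add h₂) = t} := by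
  obtain ⟨K, hK, rfl⟩ := hr
  obtain ⟨K', hK', rfl⟩ := hs
  have hα := HornProof.eigsDesc_antitone hK
  have hβ := HornProof.eigsDesc_antitone hK'
  have e := HornProof.horn_eq hα hβ
  rw [← HornProof.lMap_eq hK, ← HornProof.lMap_eq hK'] at e
  refine ⟨⟨_, K, K', hK, hK', rfl, rfl, rfl⟩, ?_, ?_⟩
  · rw [e]
    exact (HornProof.Q_compact _ _).image (LinearMap.continuous_of_finiteDimensional _)
  · rw [e]
    exact (HornProof.Q_convex hn hα hβ).linear_image _
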